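/- Let d ≥ 1, let O ⊆ ℝ^d be open, let D ⊆ ∂O, let p ∈ (0,∞) and s ∈ (0,1). Assume O satisfies the interior thickness condition in ∂O \ D with constant c > 0. Then there is a constant C > 0 (depending only on d, s, p and c) such that for every measurable f : O → ℝ with ‖f‖_{L^p(O)}^p + [f]_{W^{s,p}(O)}^p + ∫_O |f(x)|^p dist(x,D)^{-sp} dx < ∞ there exists a measurable F : ℝ^d → ℝ with F = f almost everywhere on O and ‖F‖_{L^p(ℝ^d)}^p + [F]_{W^{s,p}(ℝ^d)}^p + ∫_{ℝ^d} |F(x)|^p dist(x,D)^{-sp} dx ≤ C (‖f‖_{L^p(O)}^p + [f]_{W^{s,p}(O)}^p + ∫_O |f(x)|^p dist(x,D)^{-sp} dx). -/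

import Mathlib

open MeasureTheory Metric ENNReal

/-- The `p`-th power of the `L^p` norm of `f` on `U`. -/
noncomputable def lpPow (d : ℕ) (p : ℝ) (U : Set (EuclideanSpace ℝ (Fin d)))
    (f : EuclideanSpace ℝ (Fin d) → ℝ) : ℝ≥0∞ :=
  ∫⁻ x in U, ENNReal.ofReal (|f x| ^ p)

/-- The `p`-th power of the fractional Sobolev seminorm `[f]_{W^{s,p}(U)}`. -/
noncomputable def gagliardoPow (d : ℕ) (s p : ℝ) (U : Set (EuclideanSpace ℝ (Fin d)))
    (f : EuclideanSpace ℝ (Fin d) → ℝ) : ℝ≥0∞ :=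
  ∫⁻ x in U, ∫⁻ y in U ∩ {y | dist x y < 1},
    ENNReal.ofReal (|f x - f y| ^ p / dist x y ^ (s * p + d))

/-- The fractional Hardy term `∫_U |f(x)|^p dist(x,D)^{-sp} dx`, with the convention
`0^{-sp} = ∞` (taken in `ℝ≥0∞`) so that the weight is infinite on `D`. -/
noncomputable def hardyPow (d : ℕ) (s p : ℝ) (U D : Set (EuclideanSpace ℝ (Fin d)))
    (f : EuclideanSpace ℝ (Fin d) → ℝ) : ℝ≥0∞ :=
  ∫⁻ x in U, ENNReal.ofReal (|f x| ^ p) * ENNReal.ofReal (Metric.infDist x D) ^ (-(s * p))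

/-- `‖f‖_{L^p(U)}^p + [f]_{W^{s,p}(U)}^p + ∫_U |f|^p dist(·,D)^{-sp}`. -/
noncomputable def sobPow (d : ℕ) (s p : ℝ) (U D : Set (EuclideanSpace ℝ (Fin d)))
    (f : EuclideanSpace ℝ (Fin d) → ℝ) : ℝ≥0∞ :=
  lpPow d p U f + gagliardoPow d s p U f + hardyPow d s p U D f

/-- The real power `t ^ β` as an extended nonnegative real, with `0 ^ β = ∞` for `β < 0`. -/
noncomputable def epow (t β : ℝ) : ℝ≥0∞ := ENNReal.ofReal t ^ β

/-- The quantity `|a - b| ^ p` as an extended nonnegative real. -/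
noncomputable def powDist (p a b : ℝ) : ℝ≥0∞ := ENNReal.ofReal (|a - b| ^ p)

lemma epow_ne_top {t : ℝ} (ht : 0 < t) (β : ℝ) : epow t β ≠ ⊤ := by
  have h := ENNReal.ofReal_pos.2 ht
  exact ENNReal.rpow_ne_top_of_ne_zero h.ne' ENNReal.ofReal_ne_top

lemma epow_ne_top_of_nonneg {t β : ℝ} (hβ : 0 ≤ β) : epow t β ≠ ⊤ :=
  ENNReal.rpow_ne_top_of_nonneg hβ ENNReal.ofReal_ne_top

lemma epow_ne_zero {t : ℝ} (ht : 0 < t) (β : ℝ) : epow t β ≠ 0 := by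
  have h := ENNReal.ofReal_pos.2 ht
  exact (ENNReal.rpow_pos h ENNReal.ofReal_ne_top).ne'

lemma epow_mul_epow {t : ℝ} (ht : 0 < t) (a b : ℝ) : epow t a * epow t b = epow t (a + b) :=
  (ENNReal.rpow_add a b (ENNReal.ofReal_pos.2 ht).ne' ENNReal.ofReal_ne_top).symm

lemma epow_mul {s t : ℝ} (hs : 0 < s) (β : ℝ) : epow (s * t) β = epow s β * epow t β := by
  unfold epow
  rw [ENNReal.ofReal_mul hs.le]
  rcases le_or_gt 0 β with h | h
  · rw [ENNReal.mul_rpow_of_nonneg _ _ h]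
  · rcases le_or_gt t 0 with ht | ht
    · rw [ENNReal.ofReal_eq_zero.2 ht, mul_zero, ENNReal.zero_rpow_of_neg h, ENNReal.mul_top]
      exact epow_ne_zero hs β
    · rw [ENNReal.mul_rpow_of_ne_zero (ENNReal.ofReal_pos.2 hs).ne' (ENNReal.ofReal_pos.2 ht).ne']

lemma epow_eq_ofReal {t : ℝ} (ht : 0 < t) (β : ℝ) : epow t β = ENNReal.ofReal (t ^ β) :=
  ENNReal.ofReal_rpow_of_pos ht

lemma epow_mono {s t β : ℝ} (hβ : 0 ≤ β) (h : s ≤ t) : epow s β ≤ epow t β :=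
  ENNReal.rpow_le_rpow (ENNReal.ofReal_le_ofReal h) hβ

lemma epow_anti {s t γ : ℝ} (hγ : 0 ≤ γ) (h : s ≤ t) : epow t (-γ) ≤ epow s (-γ) := by
  unfold epow
  rw [ENNReal.rpow_neg, ENNReal.rpow_neg, ENNReal.inv_le_inv]
  exact epow_mono hγ h

/-- Comparability of negative powers of comparable quantities. -/
lemma epow_neg_le {s t K γ : ℝ} (hγ : 0 ≤ γ) (hK : 0 < K) (h : s ≤ K * t) :
    epow t (-γ) ≤ epow K γ * epow s (-γ) := by
  have h1 : epow (K * t) (-γ) ≤ epow s (-γ) := epow_anti hγ h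
  rw [epow_mul hK] at h1
  calc epow t (-γ) = epow K γ * (epow K (-γ) * epow t (-γ)) := by
        rw [← mul_assoc, epow_mul_epow hK, add_neg_cancel]; simp [epow]
    _ ≤ _ := by gcongr

@[fun_prop]
lemma Measurable.epow {α : Type*} [MeasurableSpace α] {g : α → ℝ} (hg : Measurable g) (β : ℝ) :
    Measurable fun x => epow (g x) β :=
  (ENNReal.measurable_ofReal.comp hg).pow_const β

@[fun_prop]
lemma Measurable.powDist {α : Type*} [MeasurableSpace α] {g h : α → ℝ} (hg : Measurable g)
    (hh : Measurable h) (p : ℝ) : Measurable fun x => powDist p (g x) (h x) := by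
  unfold _root_.powDist
  exact ENNReal.measurable_ofReal.comp
    ((continuous_abs.measurable.comp (hg.sub hh)).pow_const p)

lemma powDist_ne_top (p a b : ℝ) : powDist p a b ≠ ⊤ := ENNReal.ofReal_ne_top

lemma powDist_comm (p a b : ℝ) : powDist p a b = powDist p b a := by
  unfold powDist; rw [abs_sub_comm]

lemma powDist_self {p : ℝ} (hp : 0 < p) (a : ℝ) : powDist p a a = 0 := by
  unfold powDist; simp [Real.zero_rpow hp.ne']

/-- Quasi-triangle inequality, with the common point in the first arguments. -/
lemma powDist_le {p : ℝ} (hp : 0 < p) (a b c : ℝ) :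
    powDist p a b ≤ epow 2 p * (powDist p c a + powDist p c b) := by
  unfold powDist
  rw [epow_eq_ofReal two_pos, ← ENNReal.ofReal_add (by positivity) (by positivity),
    ← ENNReal.ofReal_mul (by positivity)]
  apply ENNReal.ofReal_le_ofReal
  have h1 : |a - b| ≤ 2 * max |c - a| |c - b| := by
    have := abs_sub_le a c b
    rw [abs_sub_comm a c] at this
    linarith [le_max_left |c - a| |c - b|, le_max_right |c - a| |c - b|]
  calc |a - b| ^ p ≤ (2 * max |c - a| |c - b|) ^ p := by gcongr
    _ = 2 ^ p * (max |c - a| |c - b|) ^ p := Real.mul_rpow two_pos.le (by positivity)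
    _ ≤ 2 ^ p * (|c - a| ^ p + |c - b| ^ p) := by
      gcongr
      rcases max_choice |c - a| |c - b| with h | h <;> rw [h]
      · linarith [Real.rpow_nonneg (abs_nonneg (c - b)) p]
      · linarith [Real.rpow_nonneg (abs_nonneg (c - a)) p]

lemma volume_ball_eq {d : ℕ} (x : EuclideanSpace ℝ (Fin d)) {r : ℝ} (hr : 0 < r) :
    volume (ball x r) = epow r d * volume (ball (0 : EuclideanSpace ℝ (Fin d)) 1) := by
  rw [Measure.addHaar_ball_of_pos _ _ hr, epow_eq_ofReal hr, Real.rpow_natCast]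
  simp

/-- A kernel of order `-(d + β)`, regularised at scale `r`, has integral of order `r ^ (-β)`. -/
lemma lintegral_kernel_le (d : ℕ) {β : ℝ} (hβ : 0 < β) :
    ∃ C : ℝ≥0∞, C ≠ ⊤ ∧ C ≠ 0 ∧ ∀ (x : EuclideanSpace ℝ (Fin d)) (r : ℝ), 0 ≤ r →
      ∫⁻ y, epow (dist y x + r) (-(d + β)) ≤ C * epow r (-β) := by
  have hfin : ∫⁻ z : EuclideanSpace ℝ (Fin d), ENNReal.ofReal ((1 + ‖z‖) ^ (-(d + β))) < ⊤ :=
    finite_integral_one_add_norm (by simp; linarith)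
  refine ⟨(∫⁻ z : EuclideanSpace ℝ (Fin d), ENNReal.ofReal ((1 + ‖z‖) ^ (-(d + β)))) + 1,
    by finiteness, by simp, fun x r hr => ?_⟩
  rcases hr.eq_or_lt with rfl | hr
  · rw [epow, ENNReal.ofReal_zero, ENNReal.zero_rpow_of_neg (by linarith), ENNReal.mul_top (by simp)]
    exact le_top
  have hm : Measurable fun y : EuclideanSpace ℝ (Fin d) => epow (‖y‖ + r) (-(d + β)) := by fun_prop
  have h1 : ∫⁻ y, epow (dist y x + r) (-(d + β))
      = ∫⁻ y : EuclideanSpace ℝ (Fin d), epow (‖y‖ + r) (-(d + β)) := by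
    simp_rw [dist_eq_norm]
    exact lintegral_sub_right_eq_self
      (fun y : EuclideanSpace ℝ (Fin d) => epow (‖y‖ + r) (-(d + β))) x
  have h2 : ∫⁻ z : EuclideanSpace ℝ (Fin d), epow (‖r • z‖ + r) (-(d + β))
      = epow r (-d) * ∫⁻ y : EuclideanSpace ℝ (Fin d), epow (‖y‖ + r) (-(d + β)) := by
    rw [← lintegral_map hm (measurable_const_smul r), Measure.map_addHaar_smul _ hr.ne',
      lintegral_smul_measure, smul_eq_mul, epow_eq_ofReal hr, abs_of_nonneg (by positivity),
      Real.rpow_neg hr.le, Real.rpow_natCast]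
    simp
  have h3 : ∀ z : EuclideanSpace ℝ (Fin d), epow (‖r • z‖ + r) (-(d + β))
      = epow r (-(d + β)) * ENNReal.ofReal ((1 + ‖z‖) ^ (-(d + β))) := fun z => by
    rw [← epow_eq_ofReal (by positivity), ← epow_mul hr, norm_smul, Real.norm_of_nonneg hr.le]
    ring_nf
  simp_rw [h3] at h2
  rw [lintegral_const_mul' _ _ (epow_ne_top hr _)] at h2
  calc ∫⁻ y, epow (dist y x + r) (-(d + β))
      = epow r d * (epow r (-d) * ∫⁻ y : EuclideanSpace ℝ (Fin d), epow (‖y‖ + r) (-(d + β))) := by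
        rw [h1, ← mul_assoc, epow_mul_epow hr, add_neg_cancel]; simp [epow]
    _ = epow r (-β) * ∫⁻ z : EuclideanSpace ℝ (Fin d), ENNReal.ofReal ((1 + ‖z‖) ^ (-(d + β))) := by
        rw [← h2, ← mul_assoc, epow_mul_epow hr]; congr 2; ring
    _ ≤ _ := by rw [mul_comm]; gcongr; exact le_self_add

/-- A locally integrable power of the distance, integrated over a ball. -/
lemma lintegral_ball_kernel_le {d : ℕ} (hd : 1 ≤ d) {β : ℝ} (hβ : 0 < β) :
    ∃ C : ℝ≥0∞, C ≠ ⊤ ∧ ∀ (x : EuclideanSpace ℝ (Fin d)) (r : ℝ), 0 < r →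
      ∫⁻ y in ball x r, epow (dist y x) (β - d) ≤ C * epow r β := by
  have : Nonempty (Fin d) := ⟨⟨0, hd⟩⟩
  have hint : IntegrableOn (fun z : EuclideanSpace ℝ (Fin d) => ‖z‖ ^ (β - d)) (ball 0 1) := by
    rw [integrableOn_fun_norm_addHaar volume (f := fun t => t ^ (β - d))]
    have h0 : IntegrableOn (fun y : ℝ => y ^ (β - 1)) (Set.Ioo 0 1) := by
      have := intervalIntegral.intervalIntegrable_rpow' (a := 0) (b := 1)
        (show -1 < β - 1 by linarith)
      rw [intervalIntegrable_iff_integrableOn_Ioo_of_le zero_le_one] at this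
      exact this
    refine h0.congr_fun (fun y hy => ?_) measurableSet_Ioo
    simp only [smul_eq_mul, finrank_euclideanSpace, Fintype.card_fin]
    rw [← Real.rpow_natCast, ← Real.rpow_add hy.1]
    congr 1
    push_cast [Nat.cast_sub hd]
    ring
  have hfin : ∫⁻ z in ball (0 : EuclideanSpace ℝ (Fin d)) 1, epow ‖z‖ (β - d) < ⊤ := by
    have h1 := hint.setLIntegral_lt_top
    refine lt_of_le_of_lt (le_of_eq ?_) h1
    refine setLIntegral_congr_fun_ae measurableSet_ball ?_
    have : ∀ᵐ z : EuclideanSpace ℝ (Fin d), z ≠ 0 := by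
      simp [ae_iff]
    filter_upwards [this] with z hz _
    exact epow_eq_ofReal (norm_pos_iff.2 hz) _
  refine ⟨_, hfin.ne, fun x r hr => ?_⟩
  have hm : Measurable fun y : EuclideanSpace ℝ (Fin d) =>
      (ball (0 : EuclideanSpace ℝ (Fin d)) r).indicator (fun y => epow ‖y‖ (β - d)) y :=
    Measurable.indicator (by fun_prop) measurableSet_ball
  have h1 : ∫⁻ y in ball x r, epow (dist y x) (β - d) = ∫⁻ y : EuclideanSpace ℝ (Fin d),
      (ball (0 : EuclideanSpace ℝ (Fin d)) r).indicator (fun y => epow ‖y‖ (β - d)) y := by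
    rw [← lintegral_indicator measurableSet_ball, ← lintegral_sub_right_eq_self
      (fun y => (ball (0 : EuclideanSpace ℝ (Fin d)) r).indicator (fun y => epow ‖y‖ (β - d)) y) x]
    refine lintegral_congr fun y => ?_
    simp [Set.indicator, dist_eq_norm]
  have h2 : ∫⁻ z : EuclideanSpace ℝ (Fin d),
      (ball (0 : EuclideanSpace ℝ (Fin d)) r).indicator (fun y => epow ‖y‖ (β - d)) (r • z)
      = epow r (-d) * ∫⁻ y : EuclideanSpace ℝ (Fin d),
        (ball (0 : EuclideanSpace ℝ (Fin d)) r).indicator (fun y => epow ‖y‖ (β - d)) y := by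
    rw [← lintegral_map hm (measurable_const_smul r), Measure.map_addHaar_smul _ hr.ne',
      lintegral_smul_measure, smul_eq_mul, epow_eq_ofReal hr, abs_of_nonneg (by positivity),
      Real.rpow_neg hr.le, Real.rpow_natCast]
    simp
  have h3 : ∀ z : EuclideanSpace ℝ (Fin d),
      (ball (0 : EuclideanSpace ℝ (Fin d)) r).indicator (fun y => epow ‖y‖ (β - d)) (r • z)
      = epow r (β - d) * (ball (0 : EuclideanSpace ℝ (Fin d)) 1).indicator
        (fun y => epow ‖y‖ (β - d)) z := fun z => by
    have hiff : r * ‖z‖ < r ↔ ‖z‖ < 1 := by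
      constructor <;> intro h <;> nlinarith
    by_cases hz : ‖z‖ < 1
    · simp [Set.indicator, norm_smul, abs_of_pos hr, hiff, hz, epow_mul hr]
    · simp [Set.indicator, norm_smul, abs_of_pos hr, hiff, hz]
  simp_rw [h3] at h2
  rw [lintegral_const_mul' _ _ (epow_ne_top hr _), lintegral_indicator measurableSet_ball] at h2
  refine le_of_eq ?_
  rw [h1]
  calc _ = epow r d * (epow r (-d) * ∫⁻ y : EuclideanSpace ℝ (Fin d),
        (ball (0 : EuclideanSpace ℝ (Fin d)) r).indicator (fun y => epow ‖y‖ (β - d)) y) := by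
        rw [← mul_assoc, epow_mul_epow hr, add_neg_cancel]; simp [epow]
    _ = _ := by
        rw [← h2, ← mul_assoc, epow_mul_epow hr, mul_comm]; congr 2; ring

/-- Tonelli for a regularised kernel. -/
lemma lintegral_lintegral_kernel_le (d : ℕ) {β : ℝ} (hβ : 0 < β) :
    ∃ C : ℝ≥0∞, C ≠ ⊤ ∧ C ≠ 0 ∧ ∀ {Y : Type} [MeasurableSpace Y] (ν : Measure Y) [SFinite ν]
      (g : Y → ℝ≥0∞) (π : Y → EuclideanSpace ℝ (Fin d)) (h : Y → ℝ), Measurable g → Measurable π →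
      Measurable h → (∀ y, 0 ≤ h y) →
      ∫⁻ x, ∫⁻ y, g y * epow (dist x (π y) + h y) (-(d + β)) ∂ν ≤
        C * ∫⁻ y, g y * epow (h y) (-β) ∂ν := by
  obtain ⟨C, hC, hC0, hk⟩ := lintegral_kernel_le d hβ
  refine ⟨C, hC, hC0, fun {Y} _ ν _ g π h hg hπ hh hnn => ?_⟩
  rw [lintegral_lintegral_swap (by fun_prop), ← lintegral_const_mul' _ _ hC]
  refine lintegral_mono fun y => ?_
  rw [lintegral_const_mul _ (by fun_prop)]
  calc g y * ∫⁻ x, epow (dist x (π y) + h y) (-(d + β)) ≤ g y * (C * epow (h y) (-β)) := by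
        gcongr; exact hk _ _ (hnn y)
    _ = _ := by ring

/-- Comparison of a value with another one through an average over a set of large measure. -/
lemma mul_powDist_le {Y : Type*} [MeasurableSpace Y] {ν : Measure Y} {p : ℝ} (hp : 0 < p)
    {f : Y → ℝ} (hf : Measurable f) {B : Set Y} {m : ℝ≥0∞} (hm : m ≤ ν B) (a b : ℝ) :
    m * powDist p a b ≤ epow 2 p *
      ((∫⁻ u in B, powDist p (f u) a ∂ν) + ∫⁻ u in B, powDist p (f u) b ∂ν) := by
  calc m * powDist p a b ≤ ν B * powDist p a b := by gcongr
    _ = ∫⁻ _ in B, powDist p a b ∂ν := by rw [setLIntegral_const, mul_comm]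
    _ ≤ ∫⁻ u in B, epow 2 p * (powDist p (f u) a + powDist p (f u) b) ∂ν :=
      lintegral_mono fun u => powDist_le hp a b (f u)
    _ = _ := by
      rw [lintegral_const_mul' _ _ (epow_ne_top two_pos p), lintegral_add_left (by fun_prop)]

/-- Comparison of values through an average over a set of measure at least `θ t ^ d`. -/
lemma powDist_le_average {Y : Type*} [MeasurableSpace Y] {ν : Measure Y} {p : ℝ} (hp : 0 < p)
    {f : Y → ℝ} (hf : Measurable f) {B : Set Y} {θ : ℝ≥0∞} (hθ : θ ≠ 0) (hθ' : θ ≠ ⊤) {t e : ℝ}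
    (ht : 0 < t) (hm : θ * epow t e ≤ ν B) (a b : ℝ) :
    powDist p a b ≤ θ⁻¹ * epow 2 p * epow t (-e) *
      ((∫⁻ u in B, powDist p (f u) a ∂ν) + ∫⁻ u in B, powDist p (f u) b ∂ν) := by
  have h := mul_powDist_le hp hf hm a b
  calc powDist p a b = (θ⁻¹ * θ) * (epow t (-e) * epow t e) * powDist p a b := by
        rw [ENNReal.inv_mul_cancel hθ hθ', epow_mul_epow ht, neg_add_cancel]; simp [epow]
    _ = θ⁻¹ * epow t (-e) * (θ * epow t e * powDist p a b) := by ring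
    _ ≤ θ⁻¹ * epow t (-e) * (epow 2 p *
      ((∫⁻ u in B, powDist p (f u) a ∂ν) + ∫⁻ u in B, powDist p (f u) b ∂ν)) := by gcongr
    _ = _ := by ring

/-- A localized integral is dominated by a global one with a weight comparable to the scale. -/
lemma epow_mul_setLIntegral_le {Y : Type*} [MeasurableSpace Y] {ν : Measure Y} {B U : Set Y}
    (hB : MeasurableSet B) (hBU : B ⊆ U) {t K γ : ℝ} (ht : 0 < t) (hK : 0 < K) (hγ : 0 ≤ γ)
    (g : Y → ℝ≥0∞) (r : Y → ℝ) (hr : ∀ u ∈ B, r u ≤ K * t) :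
    epow t (-γ) * ∫⁻ u in B, g u ∂ν ≤ epow K γ * ∫⁻ u in U, g u * epow (r u) (-γ) ∂ν := by
  rw [← lintegral_const_mul' _ _ (epow_ne_top ht _), ← lintegral_const_mul' _ _ (epow_ne_top hK _)]
  refine (setLIntegral_mono' hB fun u hu => ?_).trans (lintegral_mono_set hBU)
  calc epow t (-γ) * g u ≤ (epow K γ * epow (r u) (-γ)) * g u := by
        gcongr; exact epow_neg_le hγ hK (hr u hu)
    _ = _ := by ring

/-- The full Gagliardo energy on `U`, without restriction on the distance of the points. -/
noncomputable def fullEnergy (d : ℕ) (s p : ℝ) (U : Set (EuclideanSpace ℝ (Fin d)))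
    (f : EuclideanSpace ℝ (Fin d) → ℝ) : ℝ≥0∞ :=
  ∫⁻ x in U, ∫⁻ y in U, powDist p (f x) (f y) * epow (dist x y) (-(s * p + d))

/-- The unweighted energy on `B`. -/
noncomputable def flatEnergy {d : ℕ} (p : ℝ) (B : Set (EuclideanSpace ℝ (Fin d)))
    (f : EuclideanSpace ℝ (Fin d) → ℝ) : ℝ≥0∞ :=
  ∫⁻ x in B, ∫⁻ y in B, powDist p (f x) (f y)

/-- The energy density of `f` on `U` seen from a point `x`. -/
noncomputable def energyDensity {d : ℕ} (s p : ℝ) (U : Set (EuclideanSpace ℝ (Fin d)))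
    (f : EuclideanSpace ℝ (Fin d) → ℝ) (x : EuclideanSpace ℝ (Fin d)) : ℝ≥0∞ :=
  ∫⁻ u in U, ∫⁻ v in U, powDist p (f u) (f v) * epow (dist x u + dist u v) (-(d + (s * p + d)))

lemma lintegral_energyDensity_le (d : ℕ) {s p : ℝ} (hs : 0 < s) (hp : 0 < p) :
    ∃ C : ℝ≥0∞, C ≠ ⊤ ∧ ∀ (U : Set (EuclideanSpace ℝ (Fin d)))
      (f : EuclideanSpace ℝ (Fin d) → ℝ), Measurable f →
      ∫⁻ x, energyDensity s p U f x ≤ C * fullEnergy d s p U f := by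
  have hsp : 0 < s * p := mul_pos hs hp
  obtain ⟨C, hC, -, h⟩ := lintegral_lintegral_kernel_le d (show 0 < s * p + d by positivity)
  refine ⟨C, hC, fun U f hf => ?_⟩
  have := h ((volume.restrict U).prod (volume.restrict U))
    (fun q : EuclideanSpace ℝ (Fin d) × EuclideanSpace ℝ (Fin d) => powDist p (f q.1) (f q.2))
    (fun q => q.1) (fun q => dist q.1 q.2) (by fun_prop) (by fun_prop) (by fun_prop)
    (fun q => dist_nonneg)
  rw [lintegral_prod _ (by fun_prop)] at this
  refine le_trans (le_of_eq ?_) this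
  refine lintegral_congr fun x => ?_
  rw [lintegral_prod _ (by fun_prop)]
  rfl

/-- The flat energy on a ball is controlled by the energy density at the center. -/
lemma flatEnergy_ball_le {d : ℕ} {s p : ℝ} (hs : 0 < s) (hp : 0 < p)
    {U : Set (EuclideanSpace ℝ (Fin d))} (hU : MeasurableSet U)
    (f : EuclideanSpace ℝ (Fin d) → ℝ) (x : EuclideanSpace ℝ (Fin d)) {K t : ℝ} (hK : 0 < K)
    (ht : 0 < t) :
    epow t (-(d + (s * p + d))) * flatEnergy p (ball x (K * t) ∩ U) f ≤
      epow (3 * K) (d + (s * p + d)) * energyDensity s p U f x := by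
  have hsp : 0 < s * p := mul_pos hs hp
  have h3 : (0 : ℝ) < 3 * K := by positivity
  have hB : MeasurableSet (ball x (K * t) ∩ U) := measurableSet_ball.inter hU
  unfold flatEnergy energyDensity
  rw [← lintegral_const_mul' _ _ (epow_ne_top ht _), ← lintegral_const_mul' _ _ (epow_ne_top h3 _)]
  refine (setLIntegral_mono' hB fun u hu => ?_).trans (lintegral_mono_set Set.inter_subset_right)
  refine epow_mul_setLIntegral_le hB Set.inter_subset_right ht h3 (by positivity) _ _ fun v hv => ?_
  have h1 := mem_ball.1 hu.1
  have h2 := mem_ball.1 hv.1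
  have := dist_triangle_right u v x
  rw [dist_comm x u]
  linarith

/-- The flat energy is finite on sets of finite measure for `p`-integrable functions. -/
lemma flatEnergy_lt_top {d : ℕ} {p : ℝ} (hp : 0 < p) {B U : Set (EuclideanSpace ℝ (Fin d))}
    {f : EuclideanSpace ℝ (Fin d) → ℝ} (hf : Measurable f) (hB : volume B < ⊤) (hBU : B ⊆ U)
    (hfin : ∫⁻ u in U, powDist p (f u) 0 < ⊤) : flatEnergy p B f < ⊤ := by
  have hB' : ∫⁻ u in B, powDist p (f u) 0 < ⊤ := (lintegral_mono_set hBU).trans_lt hfin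
  have h1 : ∀ x y, powDist p (f x) (f y) ≤
      epow 2 p * (powDist p (f x) 0 + powDist p (f y) 0) := fun x y => by
    have := powDist_le hp (f x) (f y) 0
    rwa [powDist_comm p 0, powDist_comm p 0] at this
  calc flatEnergy p B f ≤ ∫⁻ x in B, ∫⁻ y in B,
        epow 2 p * (powDist p (f x) 0 + powDist p (f y) 0) :=
        lintegral_mono fun x => lintegral_mono fun y => h1 x y
    _ = epow 2 p * (2 * volume B * ∫⁻ u in B, powDist p (f u) 0) := by
        simp_rw [lintegral_const_mul' _ _ (epow_ne_top two_pos p),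
          lintegral_add_left measurable_const, setLIntegral_const]
        rw [lintegral_add_right _ measurable_const, lintegral_mul_const _ (by fun_prop),
          setLIntegral_const]
        ring
    _ < ⊤ := by
        have := epow_ne_top two_pos p
        finiteness

/-- Thickness of `U` at all scales above `4 ρ` follows from thickness at scale `ρ`, by Vitali's
covering theorem. -/
lemma exists_thick_of_thick {d : ℕ} {c₀ : ℝ≥0∞} (hc : c₀ ≠ 0) (hc' : c₀ ≠ ⊤) :
    ∃ θ : ℝ≥0∞, θ ≠ 0 ∧ θ ≠ ⊤ ∧ ∀ (ρ : EuclideanSpace ℝ (Fin d) → ℝ)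
      (U : Set (EuclideanSpace ℝ (Fin d))), LipschitzWith 1 ρ → (∀ x, 0 ≤ ρ x) →
      MeasurableSet U → volume ({x | ρ x = 0} \ U) = 0 →
      (∀ x, 0 < ρ x → c₀ * epow (ρ x) d ≤ volume (ball x (2 * ρ x) ∩ U)) →
      ∀ x t, 0 < t → 4 * ρ x ≤ t → θ * epow t d ≤ volume (ball x t ∩ U) := by
  set v := volume (ball (0 : EuclideanSpace ℝ (Fin d)) 1) with hv
  have hv0 : v ≠ 0 := (measure_ball_pos _ _ one_pos).ne'
  have hvt : v ≠ ⊤ := measure_ball_lt_top.ne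
  have h8 : epow (1 / 8) d ≠ ⊤ := epow_ne_top (by norm_num) _
  have h10 : epow 10 d ≠ ⊤ := epow_ne_top (by norm_num) _
  set A := epow 10 d * v * c₀⁻¹ with hA
  have hAt : A ≠ ⊤ := by finiteness
  refine ⟨(1 + A)⁻¹ * (epow (1 / 8) d * v), ?_, ?_, ?_⟩
  · refine mul_ne_zero (ENNReal.inv_ne_zero.2 (by finiteness)) (mul_ne_zero ?_ hv0)
    exact epow_ne_zero (by norm_num) _
  · exact ENNReal.mul_ne_top (ENNReal.inv_ne_top.2 (by simp)) (by finiteness)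
  intro ρ U hlip hnn hU hnull hthick x t ht hxt
  have hl : ∀ y z, ρ y ≤ ρ z + dist y z := fun y z => by simpa using hlip.le_add_mul y z
  obtain ⟨w, hwT, hdisj, hcov⟩ := Vitali.exists_disjoint_subfamily_covering_enlargement_ball
    {y | y ∈ ball x (t / 8) ∧ 0 < ρ y ∧ y ∉ U} id (fun y => 2 * ρ y) t (fun y hy => by
      have := hl y x; have := mem_ball.1 hy.1; linarith) 5 (by norm_num)
  have hwc : w.Countable := hdisj.countable_of_isOpen (fun _ _ => isOpen_ball)
    fun y hy => ⟨y, mem_ball_self (by have := (hwT hy).2.1; positivity)⟩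
  have hsub : ball x (t / 8) ⊆ (ball x t ∩ U) ∪ (({x | ρ x = 0} \ U) ∪
      ⋃ b ∈ w, ball b (10 * ρ b)) := by
    intro y hy
    by_cases hyU : y ∈ U
    · exact Or.inl ⟨ball_subset_ball (by linarith) hy, hyU⟩
    rcases (hnn y).eq_or_lt with h0 | h0
    · exact Or.inr (Or.inl ⟨h0.symm, hyU⟩)
    · obtain ⟨b, hb, hsb⟩ := hcov y ⟨hy, h0, hyU⟩
      refine Or.inr (Or.inr (Set.mem_biUnion hb ?_))
      have := hsb (mem_ball_self (by positivity))
      simp only [id] at this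
      convert this using 1
      ring_nf
  have hball : ∀ b ∈ w, volume (ball b (10 * ρ b)) ≤ A * volume (ball b (2 * ρ b) ∩ U) := by
    intro b hb
    have hb0 := (hwT hb).2.1
    rw [volume_ball_eq _ (by positivity), epow_mul (by norm_num)]
    calc epow 10 d * epow (ρ b) d * v = epow 10 d * v * (c₀⁻¹ * c₀) * epow (ρ b) d := by
          rw [ENNReal.inv_mul_cancel hc hc']; ring
      _ = A * (c₀ * epow (ρ b) d) := by ring
      _ ≤ _ := by gcongr; exact hthick b hb0
  have hdisj' : w.PairwiseDisjoint fun b => ball b (2 * ρ b) ∩ U := fun i hi j hj hij =>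
    (hdisj hi hj hij).mono Set.inter_subset_left Set.inter_subset_left
  have hsum : volume (⋃ b ∈ w, ball b (10 * ρ b)) ≤ A * volume (ball x t ∩ U) := by
    calc volume (⋃ b ∈ w, ball b (10 * ρ b)) ≤ ∑' b : w, volume (ball (b : EuclideanSpace ℝ (Fin d)) (10 * ρ b)) :=
          measure_biUnion_le _ hwc _
      _ ≤ ∑' b : w, A * volume (ball (b : EuclideanSpace ℝ (Fin d)) (2 * ρ b) ∩ U) :=
          ENNReal.tsum_le_tsum fun b => hball b b.2
      _ = A * volume (⋃ b ∈ w, ball b (2 * ρ b) ∩ U) := by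
          rw [ENNReal.tsum_mul_left, measure_biUnion hwc hdisj' (fun b _ => measurableSet_ball.inter hU)]
      _ ≤ A * volume (ball x t ∩ U) := by
          gcongr
          refine Set.iUnion₂_subset fun b hb => Set.inter_subset_inter_left _ ?_
          have h1 := mem_ball.1 (hwT hb).1
          have h2 := hl b x
          exact ball_subset_ball' (by linarith)
  have hmain : epow (1 / 8) d * v * epow t d ≤ (1 + A) * volume (ball x t ∩ U) := by
    calc epow (1 / 8) d * v * epow t d = volume (ball x (t / 8)) := by
          rw [volume_ball_eq _ (by positivity), show t / 8 = 1 / 8 * t by ring,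
            epow_mul (by norm_num)]; ring
      _ ≤ volume (ball x t ∩ U) + (volume ({x | ρ x = 0} \ U) +
            volume (⋃ b ∈ w, ball b (10 * ρ b))) :=
          (measure_mono hsub).trans ((measure_union_le _ _).trans
            (by gcongr; exact measure_union_le _ _))
      _ ≤ volume (ball x t ∩ U) + (0 + A * volume (ball x t ∩ U)) := by gcongr; exact hnull.le
      _ = _ := by ring
  calc (1 + A)⁻¹ * (epow (1 / 8) d * v) * epow t d
      = (1 + A)⁻¹ * (epow (1 / 8) d * v * epow t d) := by ring
    _ ≤ (1 + A)⁻¹ * ((1 + A) * volume (ball x t ∩ U)) := by gcongr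
    _ = _ := by rw [← mul_assoc, ENNReal.inv_mul_cancel (by simp) (by finiteness), one_mul]

/-- Smoothing of a function at a variable scale `ρ`. -/
lemma exists_smoothing (d : ℕ) :
    ∃ M : ℝ, 0 ≤ M ∧ ∀ (ρ a : EuclideanSpace ℝ (Fin d) → ℝ), LipschitzWith 1 ρ → Measurable a →
      ∃ G : EuclideanSpace ℝ (Fin d) → ℝ, Measurable G ∧ ∀ x, 0 < ρ x → ∀ A S : ℝ,
        (∀ z ∈ ball x (ρ x / 8), |a z - A| ≤ S) → |G x - A| ≤ S ∧
          ∀ y, dist x y < ρ x / 32 → |G x - G y| ≤ M * S * (dist x y / ρ x) := by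
  refine ⟨128 * 4 ^ d, by positivity, fun ρ a hlip ha => ?_⟩
  have hl : ∀ y z, ρ y ≤ ρ z + dist y z := fun y z => by simpa using hlip.le_add_mul y z
  have hρc : Continuous ρ := hlip.continuous
  set W : EuclideanSpace ℝ (Fin d) → EuclideanSpace ℝ (Fin d) → ℝ :=
    fun x z => max 0 (ρ x / 16 - dist x z) with hW
  have hW0 : ∀ x z, 0 ≤ W x z := fun x z => le_max_left _ _
  have hWm : Measurable fun q : EuclideanSpace ℝ (Fin d) × EuclideanSpace ℝ (Fin d) =>
      W q.1 q.2 := by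
    apply Continuous.measurable; simp only [hW]; fun_prop
  have hWm' : ∀ x, Measurable (W x) := fun x => by
    apply Continuous.measurable; simp only [hW]; fun_prop
  have hWs : ∀ x z, z ∉ ball x (ρ x / 16) → W x z = 0 := fun x z hz => by
    rw [mem_ball, dist_comm, not_lt] at hz
    exact max_eq_left (by linarith)
  have hWi : ∀ x, Integrable (W x) := fun x => by
    have : IntegrableOn (W x) (ball x (ρ x / 16)) := by
      refine Measure.integrableOn_of_bounded measure_ball_lt_top.ne
        (hWm' x).aestronglyMeasurable (M := |ρ x / 16|) (Filter.Eventually.of_forall fun z => ?_)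
      rw [Real.norm_of_nonneg (hW0 x z)]
      exact max_le (abs_nonneg _) ((sub_le_self _ dist_nonneg).trans (le_abs_self _))
    rw [integrableOn_iff_integrable_of_support_subset] at this
    · exact this
    · intro z hz; by_contra h; exact hz (hWs x z h)
  have hNlow : ∀ x, 0 < ρ x → ρ x / 32 * volume.real (ball x (ρ x / 32)) ≤ ∫ z, W x z := by
    intro x hx
    calc ρ x / 32 * volume.real (ball x (ρ x / 32)) = ∫ z in ball x (ρ x / 32), ρ x / 32 := by
          rw [setIntegral_const, smul_eq_mul, mul_comm]
      _ ≤ ∫ z in ball x (ρ x / 32), W x z := by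
          refine setIntegral_mono_on (integrableOn_const measure_ball_lt_top.ne)
            (hWi x).integrableOn measurableSet_ball fun z hz => ?_
          rw [mem_ball, dist_comm] at hz
          exact le_max_of_le_right (by linarith)
      _ ≤ ∫ z, W x z := setIntegral_le_integral (hWi x) (Filter.Eventually.of_forall (hW0 x))
  have hvpos : ∀ x, 0 < ρ x → 0 < volume.real (ball x (ρ x / 32)) := fun x hx =>
    ENNReal.toReal_pos (measure_ball_pos _ _ (by positivity)).ne' measure_ball_lt_top.ne
  have hN0 : ∀ x, 0 < ρ x → 0 < ∫ z, W x z := fun x hx =>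
    (mul_pos (by positivity) (hvpos x hx)).trans_le (hNlow x hx)
  refine ⟨fun x => (∫ z, W x z * a z) / ∫ z, W x z, ?_, ?_⟩
  · refine Measurable.div ?_ ?_
    · exact (StronglyMeasurable.integral_prod_right'
        (f := fun q : EuclideanSpace ℝ (Fin d) × EuclideanSpace ℝ (Fin d) => W q.1 q.2 * a q.2)
        (hWm.mul (ha.comp measurable_snd)).stronglyMeasurable).measurable
    · exact (StronglyMeasurable.integral_prod_right' hWm.stronglyMeasurable).measurable
  intro x hx A S hS
  have hS0 : 0 ≤ S := (abs_nonneg _).trans (hS x (mem_ball_self (by positivity)))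
  set h : EuclideanSpace ℝ (Fin d) → ℝ := (ball x (ρ x / 8)).indicator fun z => a z - A with hh
  have hhm : Measurable h := (ha.sub_const A).indicator measurableSet_ball
  have hhS : ∀ z, |h z| ≤ S := fun z => by
    by_cases hz : z ∈ ball x (ρ x / 8)
    · simpa [hh, hz] using hS z hz
    · simpa [hh, hz] using hS0
  have hsupp : ∀ y, dist x y < ρ x / 32 → ∀ z, z ∉ ball x (ρ x / 8) → W y z = 0 := by
    intro y hy z hz
    refine hWs y z fun hz' => hz ?_
    have h1 := hl y x
    have h2 := dist_triangle z y x
    rw [dist_comm y x] at h1 h2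
    rw [mem_ball] at hz' ⊢
    linarith
  have hWh : ∀ y, Integrable fun z => W y z * h z := fun y =>
    (hWi y).mul_bdd (c := S) hhm.aestronglyMeasurable (Filter.Eventually.of_forall hhS)
  have hrep : ∀ y, 0 < ρ y → dist x y < ρ x / 32 →
      (∫ z, W y z * a z) / (∫ z, W y z) - A = (∫ z, W y z * h z) / ∫ z, W y z := by
    intro y hy hxy
    have h1 : ∀ z, W y z * a z = W y z * h z + W y z * A := fun z => by
      by_cases hz : z ∈ ball x (ρ x / 8)
      · simp only [hh, Set.indicator_of_mem hz]; ring
      · simp [hsupp y hxy z hz]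
    simp_rw [h1]
    rw [integral_add (hWh y) ((hWi y).mul_const A), integral_mul_const]
    have := (hN0 y hy).ne'
    field_simp
    ring
  have hbd : ∀ y, |∫ z, W y z * h z| ≤ S * ∫ z, W y z := by
    intro y
    rw [← integral_const_mul, ← Real.norm_eq_abs]
    refine norm_integral_le_of_norm_le (G := ℝ) ((hWi y).const_mul S)
      (Filter.Eventually.of_forall fun z => ?_)
    rw [norm_mul, Real.norm_of_nonneg (hW0 y z), mul_comm]
    exact mul_le_mul_of_nonneg_right (hhS z) (hW0 y z)
  have hx0 : dist x x < ρ x / 32 := by rw [dist_self]; positivity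
  have hquot : ∀ y, 0 < ρ y → |(∫ z, W y z * h z) / ∫ z, W y z| ≤ S := fun y hy => by
    rw [abs_div, abs_of_pos (hN0 y hy), div_le_iff₀ (hN0 y hy)]
    exact hbd y
  refine ⟨by simpa only [hrep x hx hx0] using hquot x hx, fun y hy => ?_⟩
  have hy0 : 0 < ρ y := by have := hl x y; linarith
  have hWd : ∀ z, |W x z - W y z| ≤ 2 * dist x y := by
    intro z
    have h1 := hl x y
    have h2 := hl y x
    have h3 := dist_triangle x y z
    have h4 := dist_triangle y x z
    rw [dist_comm y x] at h2 h4
    refine (abs_max_sub_max_le_max 0 _ 0 _).trans (max_le (by simp) ?_)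
    rw [abs_le]
    constructor <;> linarith [dist_nonneg (x := x) (y := y)]
  have hdiff : ∀ (g : EuclideanSpace ℝ (Fin d) → ℝ) (T : ℝ), (∀ z, |g z| ≤ T) →
      Integrable (fun z => W x z * g z) → Integrable (fun z => W y z * g z) →
      |(∫ z, W x z * g z) - ∫ z, W y z * g z| ≤
        2 * dist x y * T * volume.real (ball x (ρ x / 8)) := by
    intro g T hg h1 h2
    rw [← integral_sub h1 h2, ← setIntegral_eq_integral_of_forall_compl_eq_zero
      (s := ball x (ρ x / 8))]
    · rw [← Real.norm_eq_abs]
      refine norm_setIntegral_le_of_norm_le_const measure_ball_lt_top fun z _ => ?_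
      rw [← sub_mul, norm_mul]
      exact mul_le_mul (hWd z) (hg z) (norm_nonneg _) (by positivity)
    · intro z hz
      rw [hsupp x hx0 z hz, hsupp y hy z hz]; ring
  have hd1 := hdiff h S hhS (hWh x) (hWh y)
  have hd2 := hdiff (fun _ => 1) 1 (by simp) (by simpa using hWi x) (by simpa using hWi y)
  simp only [mul_one] at hd2
  set Nx := ∫ z, W x z
  set Ny := ∫ z, W y z
  set gx := ∫ z, W x z * h z
  set gy := ∫ z, W y z * h z
  have hNx : 0 < Nx := hN0 x hx
  have hNy : 0 < Ny := hN0 y hy0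
  set V := volume.real (ball x (ρ x / 8))
  have hV : V = 4 ^ d * volume.real (ball x (ρ x / 32)) := by
    simp only [V, measureReal_def]
    rw [volume_ball_eq x (r := ρ x / 8) (by positivity),
      volume_ball_eq x (r := ρ x / 32) (by positivity), show ρ x / 8 = 4 * (ρ x / 32) by ring, epow_mul (by norm_num), ENNReal.toReal_mul,
      ENNReal.toReal_mul, ENNReal.toReal_mul, epow_eq_ofReal four_pos, Real.rpow_natCast,
      ENNReal.toReal_ofReal (by positivity)]
    ring
  have hVN : V * (ρ x / 32) ≤ 4 ^ d * Nx := by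
    have := hNlow x hx
    rw [hV]
    nlinarith [show (0 : ℝ) < 4 ^ d by positivity]
  have heq : (∫ z, W x z * a z) / Nx - (∫ z, W y z * a z) / Ny
      = ((gx - gy) - gy / Ny * (Nx - Ny)) / Nx := by
    have e1 := hrep x hx hx0
    have e2 := hrep y hy0 hy
    rw [show (∫ z, W x z * a z) / Nx - (∫ z, W y z * a z) / Ny = gx / Nx - gy / Ny by
      rw [← e1, ← e2]; ring]
    field_simp
    ring
  simp only
  rw [heq, abs_div, abs_of_pos hNx, div_le_iff₀ hNx]
  have h3 : |gy / Ny * (Nx - Ny)| ≤ S * (2 * dist x y * V) := by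
    rw [abs_mul]
    exact mul_le_mul (hquot y hy0) hd2 (abs_nonneg _) hS0
  calc |gx - gy - gy / Ny * (Nx - Ny)| ≤ 2 * dist x y * S * V + S * (2 * dist x y * V) :=
        (abs_sub _ _).trans (add_le_add hd1 h3)
    _ = 128 * S * (dist x y / ρ x) * (V * (ρ x / 32)) := by field_simp; ring
    _ ≤ 128 * S * (dist x y / ρ x) * (4 ^ d * Nx) := by gcongr
    _ = _ := by ring

/-- A measurable choice of values of `A` at points nearby at scale `ρ`. -/
lemma exists_measurable_nearby {d : ℕ} {ρ : EuclideanSpace ℝ (Fin d) → ℝ} (hlip : LipschitzWith 1 ρ)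
    (A : EuclideanSpace ℝ (Fin d) → ℝ) :
    ∃ a : EuclideanSpace ℝ (Fin d) → ℝ, Measurable a ∧ ∀ z, 0 < ρ z →
      ∃ ζ, 0 < ρ ζ ∧ dist z ζ < ρ ζ / 16 ∧ a z = A ζ := by
  classical
  set q := TopologicalSpace.denseSeq (EuclideanSpace ℝ (Fin d)) with hq
  have hex : ∀ z, ∃ n, ρ z ≤ 0 ∨ (0 < ρ (q n) ∧ dist z (q n) < ρ (q n) / 16) := by
    intro z
    rcases le_or_gt (ρ z) 0 with h | h
    · exact ⟨0, Or.inl h⟩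
    · obtain ⟨n, hn⟩ := (TopologicalSpace.denseRange_denseSeq
        (EuclideanSpace ℝ (Fin d))).exists_dist_lt z (show 0 < ρ z / 32 by positivity)
      have : ρ z ≤ ρ (q n) + dist z (q n) := by simpa using hlip.le_add_mul z (q n)
      exact ⟨n, Or.inr ⟨by linarith, by linarith⟩⟩
  have hρm : Measurable ρ := hlip.continuous.measurable
  refine ⟨fun z => A (q (Nat.find (hex z))), ?_, fun z hz => ?_⟩
  · refine (measurable_from_nat (f := fun n => A (q n))).comp (measurable_find hex fun n => ?_)
    refine (measurableSet_le hρm measurable_const).union ?_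
    by_cases h : 0 < ρ (q n)
    · simp only [h, true_and]
      exact measurableSet_lt (by fun_prop) (by fun_prop)
    · simp only [h, false_and]
      exact MeasurableSet.const False
  · rcases Nat.find_spec (hex z) with h | h
    · exact absurd h (not_le.2 hz)
    · exact ⟨_, h.1, h.2, rfl⟩

lemma abs_sub_le_of_powDist_le {p a b : ℝ} (hp : 0 < p) {T : ℝ≥0∞} (hT : T ≠ ⊤)
    (h : powDist p a b ≤ T) : |a - b| ≤ T.toReal ^ (1 / p) := by
  have h1 : |a - b| ^ p ≤ T.toReal := by
    have := ENNReal.toReal_mono hT h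
    rwa [powDist, ENNReal.toReal_ofReal (by positivity)] at this
  calc |a - b| = (|a - b| ^ p) ^ (1 / p) := by
        rw [← Real.rpow_mul (abs_nonneg _), mul_one_div_cancel hp.ne', Real.rpow_one]
    _ ≤ _ := by gcongr

lemma powDist_le_of_abs_sub_le {p a b m : ℝ} (hp : 0 < p) (hm : 0 ≤ m) {T : ℝ≥0∞} (hT : T ≠ ⊤)
    (h : |a - b| ≤ m * T.toReal ^ (1 / p)) : powDist p a b ≤ epow m p * T := by
  unfold powDist epow
  rw [ENNReal.ofReal_rpow_of_nonneg hm hp.le]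
  calc ENNReal.ofReal (|a - b| ^ p) ≤ ENNReal.ofReal ((m * T.toReal ^ (1 / p)) ^ p) := by gcongr
    _ = ENNReal.ofReal (m ^ p) * T := by
      rw [Real.mul_rpow hm (by positivity), ← Real.rpow_mul ENNReal.toReal_nonneg,
        one_div_mul_cancel hp.ne', Real.rpow_one, ENNReal.ofReal_mul (by positivity),
        ENNReal.ofReal_toReal hT]

/-- The data of an extension problem from `U` to the complement, at the scale `ρ`. -/
structure IsThickData {d : ℕ} (p : ℝ) (c₀ : ℝ≥0∞) (ρ : EuclideanSpace ℝ (Fin d) → ℝ)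
    (U : Set (EuclideanSpace ℝ (Fin d))) (f : EuclideanSpace ℝ (Fin d) → ℝ) : Prop where
  lip : LipschitzWith 1 ρ
  nonneg : ∀ x, 0 ≤ ρ x
  meas : MeasurableSet U
  null : volume ({x | ρ x = 0} \ U) = 0
  thick : ∀ x, 0 < ρ x → c₀ * epow (ρ x) d ≤ volume (ball x (2 * ρ x) ∩ U)
  const : ∀ x, 0 < ρ x → ∃ A : ℝ,
    c₀ * epow (ρ x) d * ∫⁻ u in ball x (2 * ρ x) ∩ U, powDist p (f u) A ≤
      flatEnergy p (ball x (2 * ρ x) ∩ U) f ∧ (1 ≤ ρ x → A = 0)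
  measf : Measurable f
  fin : ∫⁻ u in U, powDist p (f u) 0 < ⊤

lemma IsThickData.le_add {d : ℕ} {p : ℝ} {c₀ : ℝ≥0∞} {ρ : EuclideanSpace ℝ (Fin d) → ℝ}
    {U : Set (EuclideanSpace ℝ (Fin d))} {f : EuclideanSpace ℝ (Fin d) → ℝ}
    (H : IsThickData p c₀ ρ U f) (y z : EuclideanSpace ℝ (Fin d)) : ρ y ≤ ρ z + dist y z := by
  simpa using H.lip.le_add_mul y z

lemma lintegral_powDist_const_le (d : ℕ) {p : ℝ} (hp : 0 < p) {c₀ : ℝ≥0∞} (hc : c₀ ≠ 0)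
    (hc' : c₀ ≠ ⊤) {K : ℝ} (hK : 0 < K) :
    ∃ C : ℝ≥0∞, C ≠ ⊤ ∧ ∀ (ρ : EuclideanSpace ℝ (Fin d) → ℝ) (U : Set (EuclideanSpace ℝ (Fin d)))
      (f : EuclideanSpace ℝ (Fin d) → ℝ), IsThickData p c₀ ρ U f → ∀ (ζ : EuclideanSpace ℝ (Fin d))
      (A : ℝ) (B : Set (EuclideanSpace ℝ (Fin d))), 0 < ρ ζ →
      c₀ * epow (ρ ζ) d * ∫⁻ u in ball ζ (2 * ρ ζ) ∩ U, powDist p (f u) A ≤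
        flatEnergy p (ball ζ (2 * ρ ζ) ∩ U) f →
      ball ζ (2 * ρ ζ) ∩ U ⊆ B →
      volume B ≤ epow (K * ρ ζ) d * volume (ball (0 : EuclideanSpace ℝ (Fin d)) 1) →
      ∫⁻ u in B, powDist p (f u) A ≤ C * epow (ρ ζ) (-d) * flatEnergy p B f := by
  set v := volume (ball (0 : EuclideanSpace ℝ (Fin d)) 1) with hv
  have hvt : v ≠ ⊤ := measure_ball_lt_top.ne
  have hKt := epow_ne_top hK d
  have h2 := epow_ne_top two_pos p
  refine ⟨c₀⁻¹ * epow 2 p * (1 + epow K d * v * c₀⁻¹), by finiteness, ?_⟩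
  intro ρ U f H ζ A B hζ hA hBB hvol
  set B' := ball ζ (2 * ρ ζ) ∩ U with hB'
  have hf := H.measf
  set r := ρ ζ
  have hr := epow_ne_top hζ (-d)
  have hrr : epow r (-d) * epow r d = 1 := by rw [epow_mul_epow hζ]; simp [epow]
  have hflat : flatEnergy p B' f ≤ flatEnergy p B f := by
    unfold flatEnergy
    exact (lintegral_mono_set hBB).trans (lintegral_mono fun x => lintegral_mono_set hBB)
  set J := ∫⁻ u in B', powDist p (f u) A with hJ
  have hJle : J ≤ c₀⁻¹ * epow r (-d) * flatEnergy p B f := by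
    calc J = (c₀⁻¹ * c₀) * (epow r (-d) * epow r d) * J := by
          rw [hrr, ENNReal.inv_mul_cancel hc hc', one_mul, one_mul]
      _ = c₀⁻¹ * epow r (-d) * (c₀ * epow r d * J) := by ring
      _ ≤ _ := by gcongr; exact hA.trans hflat
  calc ∫⁻ u in B, powDist p (f u) A
      ≤ ∫⁻ u in B, c₀⁻¹ * epow 2 p * epow r (-d) * ((∫⁻ w in B', powDist p (f w) (f u)) + J) :=
        lintegral_mono fun u => powDist_le_average hp hf hc hc' hζ (H.thick ζ hζ) (f u) A
    _ ≤ ∫⁻ u in B, c₀⁻¹ * epow 2 p * epow r (-d) * ((∫⁻ w in B, powDist p (f u) (f w)) + J) := by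
        refine lintegral_mono fun u => ?_
        simp_rw [powDist_comm p _ (f u)]
        gcongr _ * (?_ + _)
        exact lintegral_mono_set hBB
    _ = c₀⁻¹ * epow 2 p * epow r (-d) * (flatEnergy p B f + J * volume B) := by
        rw [lintegral_const_mul' _ _ (by finiteness), lintegral_add_right _ measurable_const,
          setLIntegral_const]; rfl
    _ ≤ c₀⁻¹ * epow 2 p * epow r (-d) * (flatEnergy p B f +
          (c₀⁻¹ * epow r (-d) * flatEnergy p B f) * (epow (K * r) d * v)) := by gcongr
    _ = c₀⁻¹ * epow 2 p * epow r (-d) * (flatEnergy p B f +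
          c₀⁻¹ * (epow r (-d) * epow r d) * flatEnergy p B f * epow K d * v) := by
        rw [epow_mul hK]; ring
    _ = _ := by rw [hrr]; ring

/-- An extension `F` of `f` adapted to the scale `ρ`. -/
structure IsAdapted {d : ℕ} (p : ℝ) (C : ℝ≥0∞) (C' : ℝ → ℝ≥0∞) (ρ : EuclideanSpace ℝ (Fin d) → ℝ)
    (U : Set (EuclideanSpace ℝ (Fin d))) (f F : EuclideanSpace ℝ (Fin d) → ℝ) : Prop where
  meas : Measurable F
  eq : ∀ x, ρ x = 0 → F x = f x
  eq_zero : ∀ x, 2 ≤ ρ x → F x = 0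
  near : ∀ x K, 0 < ρ x → 3 ≤ K → ∫⁻ u in ball x (K * ρ x) ∩ U, powDist p (f u) (F x) ≤
    C' K * epow (ρ x) (-d) * flatEnergy p (ball x (K * ρ x) ∩ U) f
  smooth : ∀ x y, 0 < ρ x → dist x y < ρ x / 32 → powDist p (F x) (F y) ≤
    C * epow (dist x y / ρ x) p * epow (ρ x) (-(2 * d)) * flatEnergy p (ball x (3 * ρ x) ∩ U) f

/-- Existence of an extension adapted to the scale `ρ`. -/
lemma exists_adapted_extension (d : ℕ) {p : ℝ} (hp : 0 < p) {c₀ : ℝ≥0∞} (hc : c₀ ≠ 0)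
    (hc' : c₀ ≠ ⊤) :
    ∃ C : ℝ≥0∞, C ≠ ⊤ ∧ ∃ C' : ℝ → ℝ≥0∞, (∀ K, C' K ≠ ⊤) ∧
      ∀ (ρ : EuclideanSpace ℝ (Fin d) → ℝ) (U : Set (EuclideanSpace ℝ (Fin d)))
      (f : EuclideanSpace ℝ (Fin d) → ℝ), IsThickData p c₀ ρ U f →
      ∃ F : EuclideanSpace ℝ (Fin d) → ℝ, IsAdapted p C C' ρ U f F := by
  obtain ⟨M, hM, hsm⟩ := exists_smoothing d
  have hex : ∀ K : ℝ, ∃ C : ℝ≥0∞, C ≠ ⊤ ∧ (3 ≤ K → ∀ (ρ : EuclideanSpace ℝ (Fin d) → ℝ)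
      (U : Set (EuclideanSpace ℝ (Fin d)))
      (f : EuclideanSpace ℝ (Fin d) → ℝ), IsThickData p c₀ ρ U f → ∀ (ζ x : EuclideanSpace ℝ (Fin d))
      (A : ℝ), 0 < ρ x → 0 < ρ ζ → ρ x ≤ 2 * ρ ζ → dist ζ x + 2 * ρ ζ ≤ 3 * ρ x →
      c₀ * epow (ρ ζ) d * ∫⁻ u in ball ζ (2 * ρ ζ) ∩ U, powDist p (f u) A ≤
        flatEnergy p (ball ζ (2 * ρ ζ) ∩ U) f →
      ∫⁻ u in ball x (K * ρ x) ∩ U, powDist p (f u) A ≤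
        C * epow (ρ x) (-d) * flatEnergy p (ball x (K * ρ x) ∩ U) f) := by
    intro K
    by_cases hK : 3 ≤ K
    swap
    · exact ⟨0, by simp, fun h => absurd h hK⟩
    have hK0 : 0 < 2 * K := by linarith
    obtain ⟨C, hC, h⟩ := lintegral_powDist_const_le d hp hc hc' hK0
    have h2 := epow_ne_top two_pos d
    refine ⟨C * epow 2 d, by finiteness, fun _ ρ U f H ζ x A hx hζ hxζ hdist hA => ?_⟩
    refine (h ρ U f H ζ A (ball x (K * ρ x) ∩ U) hζ hA ?_ ?_).trans ?_
    · exact Set.inter_subset_inter_left _ (ball_subset_ball' (by nlinarith))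
    · refine (measure_mono Set.inter_subset_left).trans ?_
      rw [volume_ball_eq _ (by positivity)]
      gcongr
      exact epow_mono (by positivity) (by nlinarith)
    · have := epow_neg_le (γ := d) (by positivity) two_pos hxζ
      calc C * epow (ρ ζ) (-d) * flatEnergy p (ball x (K * ρ x) ∩ U) f
          ≤ C * (epow 2 d * epow (ρ x) (-d)) * flatEnergy p (ball x (K * ρ x) ∩ U) f := by gcongr
        _ = _ := by ring
  choose C₁ hC₁ hC₁' using hex
  set v := volume (ball (0 : EuclideanSpace ℝ (Fin d)) 1) with hv
  have hvt : v ≠ ⊤ := measure_ball_lt_top.ne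
  have h2 := epow_ne_top two_pos p
  have hMt : epow M p ≠ ⊤ := epow_ne_top_of_nonneg hp.le
  have hC13 := hC₁ 3
  set C₂ := c₀⁻¹ * epow 2 p * (C₁ 3 + C₁ 3) with hC₂
  have hC₂t : C₂ ≠ ⊤ := by finiteness
  refine ⟨epow M p * C₂, by finiteness,
    fun K => epow 2 p * (C₁ K + epow |K| d * v * C₂), fun K => ?_, ?_⟩
  · have := hC₁ K
    have : epow |K| d ≠ ⊤ := epow_ne_top_of_nonneg (by positivity)
    finiteness
  intro ρ U f H
  have hl := H.le_add
  have hf := H.measf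
  choose! A hA hA' using H.const
  obtain ⟨a, ha, hnear⟩ := exists_measurable_nearby H.lip A
  obtain ⟨G, hG, hGs⟩ := hsm ρ a H.lip ha
  have hρm : Measurable ρ := H.lip.continuous.measurable
  classical
  have hpos : ∀ {x}, 0 < ρ x → ¬ ρ x = 0 := fun h => h.ne'
  have hz : ∀ x z, 0 < ρ x → z ∈ ball x (ρ x / 8) → ∃ ζ, 0 < ρ ζ ∧ ρ x ≤ 2 * ρ ζ ∧
      dist ζ x + 2 * ρ ζ ≤ 3 * ρ x ∧ a z = A ζ := by
    intro x z hx hz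
    rw [mem_ball] at hz
    have hz0 : 0 < ρ z := by have := hl x z; rw [dist_comm] at this; linarith
    obtain ⟨ζ, hζ, hzζ, haz⟩ := hnear z hz0
    have h1 := hl x ζ
    have h2 := hl ζ x
    have h3 := dist_triangle ζ z x
    rw [dist_comm x ζ] at h1
    rw [dist_comm ζ z] at h3
    exact ⟨ζ, hζ, by linarith, by linarith, haz⟩
  have hint : ∀ x z K, 0 < ρ x → 3 ≤ K → z ∈ ball x (ρ x / 8) →
      ∫⁻ u in ball x (K * ρ x) ∩ U, powDist p (f u) (a z) ≤
        C₁ K * epow (ρ x) (-d) * flatEnergy p (ball x (K * ρ x) ∩ U) f := by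
    intro x z K hx hK hzx
    obtain ⟨ζ, hζ, h1, h2, haz⟩ := hz x z hx hzx
    rw [haz]
    exact hC₁' K hK ρ U f H ζ x (A ζ) hx hζ h1 h2 (hA ζ hζ)
  set T : EuclideanSpace ℝ (Fin d) → ℝ≥0∞ := fun x =>
    C₂ * epow (ρ x) (-(2 * d)) * flatEnergy p (ball x (3 * ρ x) ∩ U) f with hT
  have hTt : ∀ x, 0 < ρ x → T x ≠ ⊤ := fun x hx => by
    have h1 := epow_ne_top hx (-(2 * d))
    have h2 := (flatEnergy_lt_top hp hf ((measure_mono Set.inter_subset_left).trans_lt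
      measure_ball_lt_top) (B := ball x (3 * ρ x) ∩ U) Set.inter_subset_right H.fin).ne
    simp only [hT]; finiteness
  have haa : ∀ x z, 0 < ρ x → z ∈ ball x (ρ x / 8) → powDist p (a z) (a x) ≤ T x := by
    intro x z hx hzx
    have hm : c₀ * epow (ρ x) d ≤ volume (ball x (3 * ρ x) ∩ U) := (H.thick x hx).trans
      (measure_mono (Set.inter_subset_inter_left _ (ball_subset_ball (by linarith))))
    calc powDist p (a z) (a x) ≤ _ := powDist_le_average hp hf hc hc' hx hm _ _
      _ ≤ c₀⁻¹ * epow 2 p * epow (ρ x) (-d) *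
          (C₁ 3 * epow (ρ x) (-d) * flatEnergy p (ball x (3 * ρ x) ∩ U) f +
            C₁ 3 * epow (ρ x) (-d) * flatEnergy p (ball x (3 * ρ x) ∩ U) f) := by
          gcongr
          · exact hint x z 3 hx le_rfl hzx
          · exact hint x x 3 hx le_rfl (mem_ball_self (by positivity))
      _ = C₂ * (epow (ρ x) (-d) * epow (ρ x) (-d)) * flatEnergy p (ball x (3 * ρ x) ∩ U) f := by
          rw [hC₂]; ring
      _ = T x := by rw [epow_mul_epow hx, hT]; ring_nf
  have hmain : ∀ x, 0 < ρ x → |G x - a x| ≤ (T x).toReal ^ (1 / p) ∧ ∀ y, dist x y < ρ x / 32 →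
      |G x - G y| ≤ M * (T x).toReal ^ (1 / p) * (dist x y / ρ x) := fun x hx =>
    hGs x hx (a x) _ fun z hzx => abs_sub_le_of_powDist_le hp (hTt x hx) (haa x z hx hzx)
  refine ⟨fun x => if ρ x = 0 then f x else G x,
    Measurable.ite (hρm (measurableSet_singleton 0)) hf hG, fun x hx => by simp [hx], ?_, ?_, ?_⟩
  · intro x hx
    have hx0 : 0 < ρ x := by linarith
    have := (hGs x hx0 0 0 fun z hzx => ?_).1
    · simpa [hpos hx0] using this
    obtain ⟨ζ, hζ, h1, -, haz⟩ := hz x z hx0 hzx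
    rw [haz, hA' ζ hζ (by linarith)]
    simp
  · intro x K hx hK
    have hB : volume (ball x (K * ρ x) ∩ U) ≤ epow |K| d * epow (ρ x) d * v := by
      refine (measure_mono Set.inter_subset_left).trans ?_
      rw [volume_ball_eq _ (by positivity), abs_of_nonneg (by linarith), epow_mul (by linarith)]
    have hflat : flatEnergy p (ball x (3 * ρ x) ∩ U) f ≤ flatEnergy p (ball x (K * ρ x) ∩ U) f := by
      have hBB : ball x (3 * ρ x) ∩ U ⊆ ball x (K * ρ x) ∩ U :=
        Set.inter_subset_inter_left _ (ball_subset_ball (by gcongr))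
      exact (lintegral_mono_set hBB).trans (lintegral_mono fun x => lintegral_mono_set hBB)
    have hGa : powDist p (a x) (G x) ≤ T x := by
      have := powDist_le_of_abs_sub_le hp zero_le_one (hTt x hx)
        (by simpa using (hmain x hx).1)
      rw [powDist_comm]
      simpa [epow] using this
    simp only [hpos hx, if_false]
    have hxx := hint x x K hx hK (mem_ball_self (by positivity))
    calc ∫⁻ u in ball x (K * ρ x) ∩ U, powDist p (f u) (G x)
        ≤ ∫⁻ u in ball x (K * ρ x) ∩ U, epow 2 p * (powDist p (f u) (a x) + T x) := by
          refine lintegral_mono fun u => (powDist_le hp _ _ (a x)).trans ?_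
          rw [powDist_comm p (a x)]
          gcongr
      _ = epow 2 p * ((∫⁻ u in ball x (K * ρ x) ∩ U, powDist p (f u) (a x)) +
            T x * volume (ball x (K * ρ x) ∩ U)) := by
          rw [lintegral_const_mul' _ _ h2, lintegral_add_right _ measurable_const,
            setLIntegral_const]
      _ ≤ epow 2 p * (C₁ K * epow (ρ x) (-d) * flatEnergy p (ball x (K * ρ x) ∩ U) f +
            C₂ * epow (ρ x) (-(2 * d)) * flatEnergy p (ball x (K * ρ x) ∩ U) f *
              (epow |K| d * epow (ρ x) d * v)) := by
          simp only [hT]; gcongr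
      _ = epow 2 p * (C₁ K * epow (ρ x) (-d) * flatEnergy p (ball x (K * ρ x) ∩ U) f +
            C₂ * (epow (ρ x) (-(2 * d)) * epow (ρ x) d) * flatEnergy p (ball x (K * ρ x) ∩ U) f *
              (epow |K| d * v)) := by ring
      _ = _ := by
          rw [epow_mul_epow hx, show -(2 * (d : ℝ)) + d = -d by ring]; ring
  · intro x y hx hxy
    have hy : 0 < ρ y := by have := hl x y; linarith
    simp only [hpos hx, hpos hy, if_false]
    have := powDist_le_of_abs_sub_le (m := M * (dist x y / ρ x)) hp (by positivity) (hTt x hx)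
      (((hmain x hx).2 y hxy).trans_eq (by ring))
    refine this.trans_eq ?_
    rcases hM.eq_or_lt with h0 | h0
    · simp [← h0, epow, hp]
    · rw [epow_mul h0, hT]; ring

/-- The interaction between `F x` and the values of `f` on `U`, regularised at the scale `ρ x`. -/
noncomputable def crossDensity {d : ℕ} (s p : ℝ) (ρ : EuclideanSpace ℝ (Fin d) → ℝ)
    (U : Set (EuclideanSpace ℝ (Fin d))) (f F : EuclideanSpace ℝ (Fin d) → ℝ)
    (x : EuclideanSpace ℝ (Fin d)) : ℝ≥0∞ :=
  ∫⁻ u in U, powDist p (f u) (F x) * epow (ρ x + dist x u) (-(s * p + d))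

lemma exists_mul_epow_neg_le {a : ℝ} (ha : 0 < a) {K : ℝ≥0∞} (hK : K ≠ ⊤) :
    ∃ l : ℝ, 2 ≤ l ∧ K * epow l (-a) ≤ 2⁻¹ := by
  have h := (tendsto_rpow_neg_atTop ha).eventually
    (gt_mem_nhds (show (0 : ℝ) < 1 / (2 * (K.toReal + 1)) by positivity))
  obtain ⟨l, hl, hl2⟩ := (h.and (Filter.eventually_ge_atTop 2)).exists
  refine ⟨l, hl2, ?_⟩
  have hl0 : 0 < l := by linarith
  rw [epow_eq_ofReal hl0, ← ENNReal.ofReal_toReal hK, ← ENNReal.ofReal_mul (by positivity),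
    show (2⁻¹ : ℝ≥0∞) = ENNReal.ofReal (1 / 2) by
      rw [one_div, ENNReal.ofReal_inv_of_pos two_pos]; simp]
  apply ENNReal.ofReal_le_ofReal
  have h0 := ENNReal.toReal_nonneg (a := K)
  have h1 : K.toReal * (1 / (2 * (K.toReal + 1))) ≤ 1 / 2 := by
    rw [mul_one_div, div_le_div_iff₀ (by positivity) two_pos]; linarith
  exact (mul_le_mul_of_nonneg_left hl.le h0).trans h1

lemma crossDensity_lt_top {d : ℕ} {s p : ℝ} (hs : 0 < s) (hp : 0 < p) {c₀ C : ℝ≥0∞}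
    {C' : ℝ → ℝ≥0∞} {ρ : EuclideanSpace ℝ (Fin d) → ℝ} {U : Set (EuclideanSpace ℝ (Fin d))}
    {f F : EuclideanSpace ℝ (Fin d) → ℝ} (H : IsThickData p c₀ ρ U f)
    (_HF : IsAdapted p C C' ρ U f F) {x : EuclideanSpace ℝ (Fin d)} (hx : 0 < ρ x) :
    crossDensity s p ρ U f F x < ⊤ := by
  have hsp : 0 < s * p := mul_pos hs hp
  obtain ⟨A, hA, -, hk⟩ := lintegral_kernel_le d hsp
  have hf := H.measf
  have h2 := epow_ne_top two_pos p
  have hr := epow_ne_top hx (-(s * p + d))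
  have hr' := epow_ne_top hx (-(s * p))
  have hfin := H.fin.ne
  have hF := powDist_ne_top p 0 (F x)
  calc crossDensity s p ρ U f F x
      ≤ ∫⁻ u in U, epow 2 p * (epow (ρ x) (-(s * p + d)) * powDist p (f u) 0 +
          powDist p 0 (F x) * epow (dist u x + ρ x) (-(d + s * p))) := by
        refine lintegral_mono fun u => ?_
        rw [dist_comm u x, add_comm (dist x u), add_comm (d : ℝ)]
        calc _ ≤ epow 2 p * (powDist p 0 (f u) + powDist p 0 (F x)) *
              epow (ρ x + dist x u) (-(s * p + d)) := by gcongr; exact powDist_le hp _ _ 0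
          _ = epow 2 p * (epow (ρ x + dist x u) (-(s * p + d)) * powDist p (f u) 0 +
            powDist p 0 (F x) * epow (ρ x + dist x u) (-(s * p + d))) := by
              rw [powDist_comm p 0 (f u)]; ring
          _ ≤ _ := by
              gcongr
              exact epow_anti (by positivity) (by linarith [dist_nonneg (x := x) (y := u)])
    _ = epow 2 p * (epow (ρ x) (-(s * p + d)) * (∫⁻ u in U, powDist p (f u) 0) +
          powDist p 0 (F x) * ∫⁻ u in U, epow (dist u x + ρ x) (-(d + s * p))) := by
        rw [lintegral_const_mul' _ _ h2, lintegral_add_left (by fun_prop),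
          lintegral_const_mul' _ _ hr, lintegral_const_mul' _ _ hF]
    _ ≤ epow 2 p * (epow (ρ x) (-(s * p + d)) * (∫⁻ u in U, powDist p (f u) 0) +
          powDist p 0 (F x) * (A * epow (ρ x) (-(s * p)))) := by
        gcongr
        exact (setLIntegral_le_lintegral _ _).trans (hk x _ hx.le)
    _ < ⊤ := by finiteness

/-- Away from the zero set of `ρ`, the cross density is controlled by the energy density. -/
lemma crossDensity_le_energyDensity (d : ℕ) {s p : ℝ} (hs : 0 < s) (hp : 0 < p)
    {c₀ : ℝ≥0∞} (hc : c₀ ≠ 0) (hc' : c₀ ≠ ⊤) {C : ℝ≥0∞} {C' : ℝ → ℝ≥0∞} (hC' : ∀ K, C' K ≠ ⊤) :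
    ∃ A : ℝ≥0∞, A ≠ ⊤ ∧ ∀ (ρ : EuclideanSpace ℝ (Fin d) → ℝ) (U : Set (EuclideanSpace ℝ (Fin d)))
      (f F : EuclideanSpace ℝ (Fin d) → ℝ), IsThickData p c₀ ρ U f → IsAdapted p C C' ρ U f F →
      ∀ x, 0 < ρ x → crossDensity s p ρ U f F x ≤ A * energyDensity s p U f x := by
  have hsp : 0 < s * p := mul_pos hs hp
  obtain ⟨θ, hθ, hθ', hthick⟩ := exists_thick_of_thick (d := d) hc hc'
  set α := s * p + d with hα
  have hα0 : 0 < α := by positivity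
  obtain ⟨A, hA, -, hk⟩ := lintegral_lintegral_kernel_le d hα0
  have h2 := epow_ne_top two_pos p
  have h2α := epow_ne_top two_pos (d + α)
  have h2α' := epow_ne_top two_pos α
  have h3α := epow_ne_top three_pos (d + α)
  set K := θ⁻¹ * epow 2 p * epow 2 (d + α) * A * epow 2 α with hK
  obtain ⟨l, hl, hKl⟩ := exists_mul_epow_neg_le hsp (K := K) (by finiteness)
  have hl0 : 0 < l := by linarith
  have hld := epow_ne_top hl0 d
  have h12 := epow_ne_top (show 0 < 3 * (4 * l) by linarith) (d + α)
  have hC4 := hC' (4 * l)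
  set Q := C' (4 * l) * epow (3 * (4 * l)) (d + α) +
    θ⁻¹ * epow 2 p * epow l d * epow 3 (d + α) with hQ
  refine ⟨2 * Q, by finiteness, fun ρ U f F H HF x hx => ?_⟩
  have hf := H.measf
  have hU := H.meas
  have hth := hthick ρ U H.lip H.nonneg H.meas H.null H.thick x
  set r := ρ x with hr
  set R : EuclideanSpace ℝ (Fin d) → ℝ := fun u => r + dist x u with hR
  have hRr : ∀ u, r ≤ R u := fun u => by simp [hR]
  have hRd : ∀ u, dist x u ≤ R u := fun u => by simp [hR, hx.le]
  have hR0 : ∀ u, 0 < R u := fun u => hx.trans_le (hRr u)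
  have hRm : Measurable R := by fun_prop
  set j := crossDensity s p ρ U f F x with hj
  have hjt : j < ⊤ := crossDensity_lt_top hs hp H HF hx
  set P0 : EuclideanSpace ℝ (Fin d) → ℝ≥0∞ := (ball x (4 * l * r)).indicator fun u =>
    epow r (-α) * powDist p (f u) (F x) with hP0
  set P1 : EuclideanSpace ℝ (Fin d) → ℝ≥0∞ := fun u => ∫⁻ w in U, powDist p (f u) (f w) *
    epow (dist x u + dist u w) (-(d + α)) with hP1
  set P2 : EuclideanSpace ℝ (Fin d) → ℝ≥0∞ := fun u => ∫⁻ w in U, powDist p (f w) (F x) *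
    epow (dist u x + l / 2 * R w) (-(d + α)) with hP2
  have hpt : ∀ u ∈ U, powDist p (f u) (F x) * epow (R u) (-α) ≤ P0 u +
      (θ⁻¹ * epow 2 p * epow l d * epow 3 (d + α) * P1 u +
        θ⁻¹ * epow 2 p * epow l d * epow 2 (d + α) * P2 u) := by
    intro u _
    rcases lt_or_ge (R u) (4 * l * r) with h | h
    · refine le_trans ?_ (le_add_right le_rfl)
      have hub : u ∈ ball x (4 * l * r) := by
        rw [mem_ball, dist_comm]; exact (hRd u).trans_lt h
      simp only [hP0, Set.indicator_of_mem hub]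
      rw [mul_comm]
      gcongr
      exact epow_anti hα0.le (hRr u)
    · refine le_trans ?_ (le_add_left le_rfl)
      set t := R u / l with ht
      have ht0 : 0 < t := div_pos (hR0 u) hl0
      have hlt : l * t = R u := by rw [ht]; field_simp
      have h4 : 4 * r ≤ t := by rw [ht, le_div_iff₀ hl0]; linarith
      have htR : t ≤ R u := by nlinarith
      set B := ball x t ∩ U with hB
      have hBm : MeasurableSet B := measurableSet_ball.inter hU
      have e1 : epow (R u) (-(d + α)) * ∫⁻ w in B, powDist p (f u) (f w) ≤
          epow 3 (d + α) * P1 u := by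
        refine epow_mul_setLIntegral_le hBm Set.inter_subset_right (hR0 u) three_pos
          (by positivity) _ _ fun w hw => ?_
        have h1 := mem_ball.1 hw.1
        have h2 := dist_triangle_left u w x
        have h3 := hRd u
        rw [dist_comm w x] at h1
        linarith
      have e2 : epow (R u) (-(d + α)) * ∫⁻ w in B, powDist p (f w) (F x) ≤
          epow 2 (d + α) * P2 u := by
        refine epow_mul_setLIntegral_le hBm Set.inter_subset_right (hR0 u) two_pos
          (by positivity) _ _ fun w hw => ?_
        have h1 := mem_ball.1 hw.1
        have h3 := hRd u
        rw [dist_comm w x] at h1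
        rw [dist_comm u x]
        have h5 : R w ≤ 2 * t := by simp only [hR]; linarith
        nlinarith
      have e3 : epow t (-d) * epow (R u) (-α) = epow l d * epow (R u) (-(d + α)) := by
        rw [← hlt, epow_mul hl0, epow_mul hl0, show -(d + α) = -(d : ℝ) + -α by ring,
          ← epow_mul_epow hl0, ← epow_mul_epow ht0]
        calc _ = 1 * (epow t (-d) * (epow l (-α) * epow t (-α))) := by ring
          _ = (epow l d * epow l (-d)) * (epow t (-d) * (epow l (-α) * epow t (-α))) := by
              rw [epow_mul_epow hl0]; simp [epow]
          _ = _ := by ring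
      calc powDist p (f u) (F x) * epow (R u) (-α)
          ≤ θ⁻¹ * epow 2 p * epow t (-d) * ((∫⁻ w in B, powDist p (f w) (f u)) +
              ∫⁻ w in B, powDist p (f w) (F x)) * epow (R u) (-α) := by
            gcongr
            exact powDist_le_average hp hf hθ hθ' ht0 (hth t ht0 h4) _ _
        _ = θ⁻¹ * epow 2 p * (epow t (-d) * epow (R u) (-α)) *
            ((∫⁻ w in B, powDist p (f u) (f w)) + ∫⁻ w in B, powDist p (f w) (F x)) := by
            simp_rw [powDist_comm p _ (f u)]; ring
        _ = θ⁻¹ * epow 2 p * epow l d * (epow (R u) (-(d + α)) * (∫⁻ w in B, powDist p (f u) (f w)))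
            + θ⁻¹ * epow 2 p * epow l d * (epow (R u) (-(d + α)) *
              ∫⁻ w in B, powDist p (f w) (F x)) := by
            rw [e3]; ring
        _ ≤ θ⁻¹ * epow 2 p * epow l d * (epow 3 (d + α) * P1 u) +
            θ⁻¹ * epow 2 p * epow l d * (epow 2 (d + α) * P2 u) := by gcongr
        _ = _ := by ring
  have hP0m : Measurable P0 := (by fun_prop : Measurable fun u =>
    epow r (-α) * powDist p (f u) (F x)).indicator measurableSet_ball
  have hP1m : Measurable P1 := Measurable.lintegral_prod_right' (f := fun q :
    EuclideanSpace ℝ (Fin d) × EuclideanSpace ℝ (Fin d) => powDist p (f q.1) (f q.2) *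
    epow (dist x q.1 + dist q.1 q.2) (-(d + α))) (by fun_prop)
  have i0 : ∫⁻ u in U, P0 u ≤ C' (4 * l) * epow (3 * (4 * l)) (d + α) *
      energyDensity s p U f x := by
    rw [lintegral_indicator measurableSet_ball, Measure.restrict_restrict measurableSet_ball,
      lintegral_const_mul' _ _ (epow_ne_top hx _)]
    calc _ ≤ epow r (-α) * (C' (4 * l) * epow r (-d) *
          flatEnergy p (ball x (4 * l * r) ∩ U) f) := by
          gcongr
          exact HF.near x (4 * l) hx (by linarith)
      _ = C' (4 * l) * (epow r (-(d + α)) * flatEnergy p (ball x (4 * l * r) ∩ U) f) := by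
          rw [show -(d + α) = -(d : ℝ) + -α by ring, ← epow_mul_epow hx]; ring
      _ ≤ C' (4 * l) * (epow (3 * (4 * l)) (d + α) * energyDensity s p U f x) := by
          exact mul_le_mul' le_rfl (flatEnergy_ball_le hs hp hU f x (K := 4 * l) (by linarith) hx)
      _ = _ := by ring
  have i2 : ∫⁻ u in U, P2 u ≤ A * epow (l / 2) (-α) * j := by
    refine (setLIntegral_le_lintegral _ _).trans ?_
    have h := hk (volume.restrict U) (fun w => powDist p (f w) (F x)) (fun _ => x)
      (fun w => l / 2 * R w) (by fun_prop) (by fun_prop) (by fun_prop)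
      (fun w => mul_nonneg (by positivity) (hR0 w).le)
    refine h.trans_eq ?_
    simp_rw [epow_mul (show 0 < l / 2 by positivity)]
    rw [hj, crossDensity, mul_assoc A, ← lintegral_const_mul' _ _ (epow_ne_top (by positivity) _)]
    congr 1
    refine lintegral_congr fun u => ?_
    ring
  have hall : j ≤ Q * energyDensity s p U f x + 2⁻¹ * j := by
    calc j ≤ ∫⁻ u in U, (P0 u + (θ⁻¹ * epow 2 p * epow l d * epow 3 (d + α) * P1 u +
        θ⁻¹ * epow 2 p * epow l d * epow 2 (d + α) * P2 u)) := setLIntegral_mono' hU hpt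
      _ = (∫⁻ u in U, P0 u) + (θ⁻¹ * epow 2 p * epow l d * epow 3 (d + α) *
          energyDensity s p U f x + θ⁻¹ * epow 2 p * epow l d * epow 2 (d + α) *
            ∫⁻ u in U, P2 u) := by
          rw [lintegral_add_left hP0m, lintegral_add_left (hP1m.const_mul _),
            lintegral_const_mul' _ _ (by finiteness), lintegral_const_mul' _ _ (by finiteness)]
          rfl
      _ ≤ C' (4 * l) * epow (3 * (4 * l)) (d + α) * energyDensity s p U f x +
          (θ⁻¹ * epow 2 p * epow l d * epow 3 (d + α) *
          energyDensity s p U f x + θ⁻¹ * epow 2 p * epow l d * epow 2 (d + α) *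
            (A * epow (l / 2) (-α) * j)) := by gcongr
      _ = Q * energyDensity s p U f x + K * epow l (-(s * p)) * j := by
          have e : epow l d * epow (l / 2) (-α) = epow 2 α * epow l (-(s * p)) := by
            rw [show -(s * p) = d + -α by rw [hα]; ring, ← epow_mul_epow hl0]
            conv_rhs => rw [show l = 2 * (l / 2) by ring]
            rw [epow_mul two_pos (-α)]
            calc _ = 1 * epow (2 * (l / 2)) d * epow (l / 2) (-α) := by
                  rw [one_mul, show 2 * (l / 2) = l by ring]
              _ = (epow 2 α * epow 2 (-α)) * epow (2 * (l / 2)) d * epow (l / 2) (-α) := by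
                  rw [epow_mul_epow two_pos]; simp [epow]
              _ = _ := by ring
          calc _ = Q * energyDensity s p U f x + θ⁻¹ * epow 2 p * epow 2 (d + α) * A * j *
                (epow l d * epow (l / 2) (-α)) := by rw [hQ]; ring
            _ = _ := by rw [e, hK]; ring
      _ ≤ _ := by gcongr
  have h22 : (2 : ℝ≥0∞) * (2⁻¹ * j) = j := by
    rw [← mul_assoc, ENNReal.mul_inv_cancel two_ne_zero ofNat_ne_top, one_mul]
  have h3 : j + j ≤ 2 * Q * energyDensity s p U f x + j := by
    calc j + j = 2 * j := by ring
      _ ≤ 2 * (Q * energyDensity s p U f x + 2⁻¹ * j) := by gcongr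
      _ = 2 * Q * energyDensity s p U f x + 2 * (2⁻¹ * j) := by ring
      _ = _ := by rw [h22]
  exact (ENNReal.add_le_add_iff_right hjt.ne).1 h3

lemma lintegral_crossDensity_le (d : ℕ) {s p : ℝ} (hs : 0 < s) (hp : 0 < p)
    {c₀ : ℝ≥0∞} (hc : c₀ ≠ 0) (hc' : c₀ ≠ ⊤) {C : ℝ≥0∞} {C' : ℝ → ℝ≥0∞} (hC' : ∀ K, C' K ≠ ⊤) :
    ∃ A : ℝ≥0∞, A ≠ ⊤ ∧ ∀ (ρ : EuclideanSpace ℝ (Fin d) → ℝ) (U : Set (EuclideanSpace ℝ (Fin d)))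
      (f F : EuclideanSpace ℝ (Fin d) → ℝ), IsThickData p c₀ ρ U f → IsAdapted p C C' ρ U f F →
      ∫⁻ x, crossDensity s p ρ U f F x ≤ A * fullEnergy d s p U f := by
  obtain ⟨A, hA, h⟩ := crossDensity_le_energyDensity d hs hp hc hc' (C := C) hC'
  obtain ⟨A', hA', h'⟩ := lintegral_energyDensity_le d hs hp
  refine ⟨1 + A * A', by finiteness, fun ρ U f F H HF => ?_⟩
  have hρm : Measurable ρ := H.lip.continuous.measurable
  set Z := {x | ρ x = 0} with hZ
  have hZm : MeasurableSet Z := hρm (measurableSet_singleton 0)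
  have h1 : ∫⁻ x in Z, crossDensity s p ρ U f F x ≤ fullEnergy d s p U f := by
    calc ∫⁻ x in Z, crossDensity s p ρ U f F x
        ≤ ∫⁻ x in (Z ∩ U) ∪ (Z \ U), crossDensity s p ρ U f F x := by
          rw [Set.inter_union_sdiff]
      _ ≤ (∫⁻ x in Z ∩ U, crossDensity s p ρ U f F x) + ∫⁻ x in Z \ U, crossDensity s p ρ U f F x :=
          lintegral_union_le _ _ _
      _ = ∫⁻ x in Z ∩ U, crossDensity s p ρ U f F x := by
          rw [setLIntegral_measure_zero _ _ H.null, add_zero]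
      _ ≤ ∫⁻ x in Z ∩ U, ∫⁻ y in U, powDist p (f x) (f y) * epow (dist x y) (-(s * p + d)) := by
          refine setLIntegral_mono' (hZm.inter H.meas) fun x hx => lintegral_mono fun y => ?_
          have hx0 : ρ x = 0 := hx.1
          simp only
          rw [hx0, HF.eq x hx0, zero_add, powDist_comm]
      _ ≤ _ := lintegral_mono_set Set.inter_subset_right
  have h2 : ∫⁻ x in Zᶜ, crossDensity s p ρ U f F x ≤ A * (A' * fullEnergy d s p U f) := by
    calc ∫⁻ x in Zᶜ, crossDensity s p ρ U f F x ≤ ∫⁻ x in Zᶜ, A * energyDensity s p U f x :=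
          setLIntegral_mono' hZm.compl fun x hx =>
            h ρ U f F H HF x (lt_of_le_of_ne (H.nonneg x) (Ne.symm hx))
      _ ≤ ∫⁻ x, A * energyDensity s p U f x := setLIntegral_le_lintegral _ _
      _ = A * ∫⁻ x, energyDensity s p U f x := lintegral_const_mul' _ _ hA
      _ ≤ _ := by gcongr; exact h' U f H.measf
  rw [← lintegral_add_compl _ hZm]
  calc _ ≤ fullEnergy d s p U f + A * (A' * fullEnergy d s p U f) := add_le_add h1 h2
    _ = _ := by ring

lemma lintegral_lintegral_add_swap {X : Type*} [MeasurableSpace X] {μ : Measure X} [SFinite μ]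
    {G : X → X → ℝ≥0∞} (hG : Measurable fun q : X × X => G q.1 q.2) :
    ∫⁻ x, ∫⁻ y, (G x y + G y x) ∂μ ∂μ = 2 * ∫⁻ x, ∫⁻ y, G x y ∂μ ∂μ := by
  have h1 : ∀ x, Measurable fun y => G x y := fun x => hG.comp (by fun_prop : Measurable (Prod.mk x))
  have h2 : Measurable fun q : X × X => G q.2 q.1 := hG.comp measurable_swap
  calc ∫⁻ x, ∫⁻ y, (G x y + G y x) ∂μ ∂μ = ∫⁻ x, ((∫⁻ y, G x y ∂μ) + ∫⁻ y, G y x ∂μ) ∂μ :=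
        lintegral_congr fun x => lintegral_add_left (h1 x) _
    _ = (∫⁻ x, ∫⁻ y, G x y ∂μ ∂μ) + ∫⁻ x, ∫⁻ y, G y x ∂μ ∂μ :=
        lintegral_add_left (Measurable.lintegral_prod_right' hG) _
    _ = _ := by rw [lintegral_lintegral_swap (f := fun x y => G y x) h2.aemeasurable, two_mul]

/-- Energy of pairs of points that are close compared with the scale `ρ`. -/
lemma lintegral_close_pairs_le (d : ℕ) (hd : 1 ≤ d) {s p : ℝ} (hs : 0 < s) (hs1 : s < 1)
    (hp : 0 < p) {c₀ : ℝ≥0∞} {C : ℝ≥0∞} (hC : C ≠ ⊤) {C' : ℝ → ℝ≥0∞} :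
    ∃ A : ℝ≥0∞, A ≠ ⊤ ∧ ∀ (ρ : EuclideanSpace ℝ (Fin d) → ℝ) (U : Set (EuclideanSpace ℝ (Fin d)))
      (f F : EuclideanSpace ℝ (Fin d) → ℝ), IsThickData p c₀ ρ U f → IsAdapted p C C' ρ U f F →
      ∀ x, 0 < ρ x → ∫⁻ y in ball x (ρ x / 32), powDist p (F x) (F y) *
        epow (dist x y) (-(s * p + d)) ≤ A * energyDensity s p U f x := by
  have hsp : 0 < s * p := mul_pos hs hp
  have hβ : 0 < p - s * p := by nlinarith
  obtain ⟨A, hA, hk⟩ := lintegral_ball_kernel_le hd hβ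
  have h9 := epow_ne_top (show (0 : ℝ) < 3 * 3 by norm_num) (d + (s * p + d))
  have h32 := epow_ne_top (show (0 : ℝ) < 1 / 32 by norm_num) (p - s * p)
  refine ⟨C * A * epow (1 / 32) (p - s * p) * epow (3 * 3) (d + (s * p + d)), by finiteness,
    fun ρ U f F H HF x hx => ?_⟩
  set r := ρ x with hr
  set Φ := flatEnergy p (ball x (3 * r) ∩ U) f with hΦ
  have hΦt : Φ ≠ ⊤ := (flatEnergy_lt_top hp H.measf ((measure_mono Set.inter_subset_left).trans_lt
    measure_ball_lt_top) Set.inter_subset_right H.fin).ne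
  have hr1 := epow_ne_top hx (-p)
  have hr2 := epow_ne_top hx (-(2 * d))
  calc ∫⁻ y in ball x (r / 32), powDist p (F x) (F y) * epow (dist x y) (-(s * p + d))
      ≤ ∫⁻ y in ball x (r / 32), C * epow r (-p) * epow r (-(2 * d)) * Φ *
          epow (dist y x) (p - s * p - d) := by
        refine setLIntegral_mono' measurableSet_ball fun y hy => ?_
        rw [mem_ball] at hy
        rcases eq_or_ne x y with rfl | hxy
        · simp [powDist_self hp]
        have hδ : 0 < dist x y := dist_pos.2 hxy
        have h := HF.smooth x y hx (by rwa [dist_comm])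
        have e1 : epow (dist x y / r) p = epow r (-p) * epow (dist x y) p := by
          rw [div_eq_inv_mul, epow_mul (inv_pos.2 hx)]
          congr 1
          rw [epow, epow, ENNReal.ofReal_inv_of_pos hx, ENNReal.inv_rpow, ENNReal.rpow_neg]
        calc _ ≤ (C * epow (dist x y / r) p * epow r (-(2 * d)) * Φ) *
              epow (dist x y) (-(s * p + d)) := by gcongr
          _ = C * epow r (-p) * epow r (-(2 * d)) * Φ *
              (epow (dist x y) p * epow (dist x y) (-(s * p + d))) := by rw [e1]; ring
          _ = _ := by
              rw [epow_mul_epow hδ, dist_comm y x]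
              ring_nf
    _ = C * epow r (-p) * epow r (-(2 * d)) * Φ *
          ∫⁻ y in ball x (r / 32), epow (dist y x) (p - s * p - d) :=
        lintegral_const_mul' _ _ (by finiteness)
    _ ≤ C * epow r (-p) * epow r (-(2 * d)) * Φ * (A * epow (r / 32) (p - s * p)) := by
        gcongr; exact hk x _ (by positivity)
    _ = C * A * epow (1 / 32) (p - s * p) *
          ((epow r (-p) * epow r (-(2 * d)) * epow r (p - s * p)) * Φ) := by
        rw [show r / 32 = 1 / 32 * r by ring, epow_mul (by norm_num)]; ring
    _ = C * A * epow (1 / 32) (p - s * p) * (epow r (-(d + (s * p + d))) * Φ) := by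
        rw [epow_mul_epow hx, epow_mul_epow hx]; ring_nf
    _ ≤ C * A * epow (1 / 32) (p - s * p) *
          (epow (3 * 3) (d + (s * p + d)) * energyDensity s p U f x) :=
        mul_le_mul' le_rfl (flatEnergy_ball_le hs hp H.meas f x three_pos hx)
    _ = _ := by ring

lemma fullEnergy_univ_le (d : ℕ) (hd : 1 ≤ d) {s p : ℝ} (hs : 0 < s) (hs1 : s < 1) (hp : 0 < p)
    {c₀ : ℝ≥0∞} (hc : c₀ ≠ 0) (hc' : c₀ ≠ ⊤) {C : ℝ≥0∞} (hC : C ≠ ⊤) {C' : ℝ → ℝ≥0∞}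
    (hC' : ∀ K, C' K ≠ ⊤) :
    ∃ A : ℝ≥0∞, A ≠ ⊤ ∧ ∀ (ρ : EuclideanSpace ℝ (Fin d) → ℝ) (U : Set (EuclideanSpace ℝ (Fin d)))
      (f F : EuclideanSpace ℝ (Fin d) → ℝ), IsThickData p c₀ ρ U f → IsAdapted p C C' ρ U f F →
      fullEnergy d s p Set.univ F ≤ A * fullEnergy d s p U f := by
  have hsp : 0 < s * p := mul_pos hs hp
  obtain ⟨θ, hθ, hθ', hthick⟩ := exists_thick_of_thick (d := d) hc hc'
  obtain ⟨A₁, hA₁, hclose⟩ := lintegral_close_pairs_le d hd hs hs1 hp (c₀ := c₀) hC (C' := C')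
  obtain ⟨A₂, hA₂, hdens⟩ := lintegral_energyDensity_le d hs hp
  obtain ⟨A₃, hA₃, hcross⟩ := lintegral_crossDensity_le d hs hp hc hc' (C := C) hC'
  set α := s * p + d with hα
  have hα0 : 0 < α := by positivity
  obtain ⟨A₄, hA₄, -, hk⟩ := lintegral_lintegral_kernel_le d hα0
  have h2 := epow_ne_top two_pos p
  have h2α := epow_ne_top two_pos (d + α)
  have h128 := epow_ne_top (show (0 : ℝ) < 128 by norm_num) α
  set c := θ⁻¹ * epow 2 p * epow 128 α * epow 2 (d + α) with hcdef
  have hct : c ≠ ⊤ := by finiteness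
  refine ⟨2 * (c * A₄ * A₃ + A₁ * A₂), by finiteness, fun ρ U f F H HF => ?_⟩
  have hf := H.measf
  have hF := HF.meas
  have hρm : Measurable ρ := H.lip.continuous.measurable
  set N : EuclideanSpace ℝ (Fin d) → EuclideanSpace ℝ (Fin d) → ℝ≥0∞ := fun x y =>
    ∫⁻ u in U, powDist p (f u) (F x) * epow (dist y x + (ρ x + dist x u)) (-(d + α)) with hN
  have hNm : Measurable fun q : EuclideanSpace ℝ (Fin d) × EuclideanSpace ℝ (Fin d) =>
      N q.1 q.2 := Measurable.lintegral_prod_right' (f := fun q :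
        (EuclideanSpace ℝ (Fin d) × EuclideanSpace ℝ (Fin d)) × EuclideanSpace ℝ (Fin d) =>
        powDist p (f q.2) (F q.1.1) *
          epow (dist q.1.2 q.1.1 + (ρ q.1.1 + dist q.1.1 q.2)) (-(d + α))) (by fun_prop)
  set S : Set (EuclideanSpace ℝ (Fin d) × EuclideanSpace ℝ (Fin d)) :=
    {q | dist q.2 q.1 < ρ q.1 / 32} with hS
  have hSm : MeasurableSet S := measurableSet_lt (by fun_prop) (by fun_prop)
  set E : EuclideanSpace ℝ (Fin d) → EuclideanSpace ℝ (Fin d) → ℝ≥0∞ := fun x y =>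
    powDist p (F x) (F y) * epow (dist x y) (-α) with hE
  have hEm : Measurable fun q : EuclideanSpace ℝ (Fin d) × EuclideanSpace ℝ (Fin d) =>
    E q.1 q.2 := by fun_prop
  set V : EuclideanSpace ℝ (Fin d) → EuclideanSpace ℝ (Fin d) → ℝ≥0∞ := fun x y =>
    S.indicator (fun q => E q.1 q.2) (x, y) with hV
  have hVm : Measurable fun q : EuclideanSpace ℝ (Fin d) × EuclideanSpace ℝ (Fin d) =>
    V q.1 q.2 := hEm.indicator hSm
  have hEsymm : ∀ x y, E x y = E y x := fun x y => by
    simp only [hE]; rw [powDist_comm, dist_comm]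
  have hpt : ∀ x y, E x y ≤ (c * N x y + V x y) + (c * N y x + V y x) := by
    intro x y
    by_cases hxy : (x, y) ∈ S
    · refine le_add_right (le_add_left ?_)
      simp [hV, hxy]
    by_cases hyx : (y, x) ∈ S
    · refine le_add_left (le_add_left ?_)
      rw [hEsymm]
      simp [hV, hyx]
    rcases eq_or_ne x y with rfl | hne
    · simp [hE, powDist_self hp]
    have hδ : 0 < dist x y := dist_pos.2 hne
    simp only [hS, Set.mem_ofPred_eq, not_lt] at hxy hyx
    rw [dist_comm] at hxy
    set δ := dist x y with hδd
    set t := 128 * δ with ht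
    have ht0 : 0 < t := by positivity
    have hBm : MeasurableSet (ball x t ∩ U) := measurableSet_ball.inter H.meas
    have e1 : epow t (-(d + α)) * ∫⁻ u in ball x t ∩ U, powDist p (f u) (F x) ≤
        epow 2 (d + α) * N x y := by
      refine epow_mul_setLIntegral_le hBm Set.inter_subset_right ht0 two_pos
        (by positivity) _ _ fun u hu => ?_
      have h1 := mem_ball.1 hu.1
      rw [dist_comm] at h1
      rw [dist_comm y x]
      linarith
    have e2 : epow t (-(d + α)) * ∫⁻ u in ball x t ∩ U, powDist p (f u) (F y) ≤
        epow 2 (d + α) * N y x := by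
      refine epow_mul_setLIntegral_le hBm Set.inter_subset_right ht0 two_pos
        (by positivity) _ _ fun u hu => ?_
      have h1 := mem_ball.1 hu.1
      have h2 := dist_triangle_left y u x
      rw [dist_comm] at h1
      linarith
    have e3 : epow t (-d) * epow δ (-α) = epow 128 α * epow t (-(d + α)) := by
      rw [show -(d + α) = -(d : ℝ) + -α by ring, ← epow_mul_epow ht0]
      conv_rhs => rw [ht, epow_mul (by norm_num) (-α)]
      calc _ = 1 * epow t (-d) * epow δ (-α) := by ring
        _ = (epow 128 α * epow 128 (-α)) * epow t (-d) * epow δ (-α) := by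
            rw [epow_mul_epow (by norm_num)]; simp [epow]
        _ = _ := by ring
    calc E x y ≤ θ⁻¹ * epow 2 p * epow t (-d) * ((∫⁻ u in ball x t ∩ U, powDist p (f u) (F x)) +
          ∫⁻ u in ball x t ∩ U, powDist p (f u) (F y)) * epow δ (-α) := by
          simp only [hE]
          gcongr
          exact powDist_le_average hp hf hθ hθ' ht0 (hthick ρ U H.lip H.nonneg H.meas H.null
            H.thick x t ht0 (by linarith)) _ _
      _ = θ⁻¹ * epow 2 p * (epow t (-d) * epow δ (-α)) *
          ((∫⁻ u in ball x t ∩ U, powDist p (f u) (F x)) +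
            ∫⁻ u in ball x t ∩ U, powDist p (f u) (F y)) := by ring
      _ = θ⁻¹ * epow 2 p * epow 128 α *
          (epow t (-(d + α)) * (∫⁻ u in ball x t ∩ U, powDist p (f u) (F x)) +
            epow t (-(d + α)) * ∫⁻ u in ball x t ∩ U, powDist p (f u) (F y)) := by
          rw [e3]; ring
      _ ≤ θ⁻¹ * epow 2 p * epow 128 α * (epow 2 (d + α) * N x y + epow 2 (d + α) * N y x) := by
          gcongr
      _ = c * N x y + c * N y x := by rw [hcdef]; ring
      _ ≤ _ := by gcongr <;> exact le_add_right le_rfl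
  have hVint : ∀ x, ∫⁻ y, V x y ≤ A₁ * energyDensity s p U f x := by
    intro x
    have hVx : ∀ y, V x y = (ball x (ρ x / 32)).indicator (E x) y := fun y => by
      simp only [hV, Set.indicator, hS, Set.mem_ofPred_eq, mem_ball]
    simp_rw [hVx]
    rw [lintegral_indicator measurableSet_ball]
    rcases (H.nonneg x).eq_or_lt with h0 | h0
    · simp [← h0]
    · exact hclose ρ U f F H HF x h0
  have hNint : ∀ x, ∫⁻ y, N x y ≤ A₄ * crossDensity s p ρ U f F x := fun x =>
    hk (volume.restrict U) (fun u => powDist p (f u) (F x)) (fun _ => x)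
      (fun u => ρ x + dist x u) (by fun_prop) (by fun_prop) (by fun_prop)
      (fun u => add_nonneg (H.nonneg x) dist_nonneg)
  have hinner : ∀ x, ∫⁻ y, (c * N x y + V x y) ≤
      c * (A₄ * crossDensity s p ρ U f F x) + A₁ * energyDensity s p U f x := by
    intro x
    have hVx : Measurable fun y => V x y := 
      Measurable.of_uncurry_left (f := V) hVm
    calc ∫⁻ y, (c * N x y + V x y) = (∫⁻ y, c * N x y) + ∫⁻ y, V x y :=
          lintegral_add_right (fun y => c * N x y) hVx
      _ = c * (∫⁻ y, N x y) + ∫⁻ y, V x y := by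
          congr 1
          exact lintegral_const_mul' c (fun y => N x y) hct
      _ ≤ _ := add_le_add (mul_le_mul' le_rfl (hNint x)) (hVint x)
  have hcr := hcross ρ U f F H HF
  have hde := hdens U f hf
  calc fullEnergy d s p Set.univ F = ∫⁻ x, ∫⁻ y, E x y := by
        simp only [fullEnergy, Measure.restrict_univ, hE]; rfl
    _ ≤ ∫⁻ x, ∫⁻ y, ((c * N x y + V x y) + (c * N y x + V y x)) :=
        lintegral_mono fun x => lintegral_mono fun y => hpt x y
    _ = 2 * ∫⁻ x, ∫⁻ y, (c * N x y + V x y) :=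
        lintegral_lintegral_add_swap ((hNm.const_mul c).add hVm)
    _ ≤ 2 * ∫⁻ x, (c * (A₄ * crossDensity s p ρ U f F x) + A₁ * energyDensity s p U f x) :=
        mul_le_mul' le_rfl (lintegral_mono fun x => hinner x)
    _ = 2 * (c * (A₄ * ∫⁻ x, crossDensity s p ρ U f F x) + A₁ * ∫⁻ x, energyDensity s p U f x) := by
        have hm : Measurable fun x => energyDensity s p U f x := by
          unfold energyDensity
          refine Measurable.lintegral_prod_right' (f := fun q :
            EuclideanSpace ℝ (Fin d) × EuclideanSpace ℝ (Fin d) => ∫⁻ v in U,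
            powDist p (f q.2) (f v) * epow (dist q.1 q.2 + dist q.2 v) (-(d + (s * p + d)))) ?_
          exact Measurable.lintegral_prod_right' (f := fun q :
            (EuclideanSpace ℝ (Fin d) × EuclideanSpace ℝ (Fin d)) × EuclideanSpace ℝ (Fin d) =>
            powDist p (f q.1.2) (f q.2) *
              epow (dist q.1.1 q.1.2 + dist q.1.2 q.2) (-(d + (s * p + d)))) (by fun_prop)
        rw [lintegral_add_right _ (hm.const_mul A₁), lintegral_const_mul' _ _ hct,
          lintegral_const_mul' _ _ hA₄, lintegral_const_mul' _ _ hA₁]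
    _ ≤ 2 * (c * (A₄ * (A₃ * fullEnergy d s p U f)) + A₁ * (A₂ * fullEnergy d s p U f)) := by
        gcongr
    _ = _ := by ring

/-- Weighted integrability of the extension. -/
lemma lintegral_weight_le (d : ℕ) {s p : ℝ} (hs : 0 < s) (hp : 0 < p)
    {c₀ : ℝ≥0∞} (hc : c₀ ≠ 0) (hc' : c₀ ≠ ⊤) {C : ℝ≥0∞} {C' : ℝ → ℝ≥0∞} (hC' : ∀ K, C' K ≠ ⊤) :
    ∃ A : ℝ≥0∞, A ≠ ⊤ ∧ ∀ (ρ τ : EuclideanSpace ℝ (Fin d) → ℝ)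
      (U : Set (EuclideanSpace ℝ (Fin d)))
      (f F : EuclideanSpace ℝ (Fin d) → ℝ), IsThickData p c₀ ρ U f → IsAdapted p C C' ρ U f F →
      LipschitzWith 1 τ → (∀ x, 0 ≤ τ x) → (∀ x, ρ x < 2 → ρ x ≤ 2 * τ x) →
      ∫⁻ x, powDist p (F x) 0 * epow (τ x) (-(s * p)) ≤
        A * ((∫⁻ u in U, powDist p (f u) 0 * epow (τ u) (-(s * p))) + fullEnergy d s p U f) := by
  have hsp : 0 < s * p := mul_pos hs hp
  obtain ⟨θ, hθ, hθ', hthick⟩ := exists_thick_of_thick (d := d) hc hc'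
  obtain ⟨A₃, hA₃, hcross⟩ := lintegral_crossDensity_le d hs hp hc hc' (C := C) hC'
  obtain ⟨A₄, hA₄, -, hk⟩ := lintegral_lintegral_kernel_le d hsp
  set γ := d + s * p with hγ
  have hγ0 : 0 ≤ γ := by positivity
  have h2 := epow_ne_top two_pos p
  have h2γ := epow_ne_top two_pos γ
  have h3γ := epow_ne_top three_pos γ
  have h8 := epow_ne_top (show (0 : ℝ) < 8 by norm_num) (s * p)
  set c := θ⁻¹ * epow 2 p * epow 8 (s * p) with hcdef
  have hct : c ≠ ⊤ := by finiteness
  refine ⟨1 + (c * epow 2 γ * A₃ + c * epow 3 γ * A₄), by finiteness,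
    fun ρ τ U f F H HF hτ hτ0 hρτ => ?_⟩
  have hf := H.measf
  have hF := HF.meas
  have hρm : Measurable ρ := H.lip.continuous.measurable
  have hτm : Measurable τ := hτ.continuous.measurable
  set W := ∫⁻ u in U, powDist p (f u) 0 * epow (τ u) (-(s * p)) with hW
  set Q : EuclideanSpace ℝ (Fin d) → ℝ≥0∞ := fun x =>
    ∫⁻ u in U, powDist p (f u) 0 * epow (dist x u + τ u) (-γ) with hQ
  have hQm : Measurable Q := Measurable.lintegral_prod_right' (f := fun q :
      EuclideanSpace ℝ (Fin d) × EuclideanSpace ℝ (Fin d) =>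
      powDist p (f q.2) 0 * epow (dist q.1 q.2 + τ q.2) (-γ)) (by fun_prop)
  have hQint : ∫⁻ x, Q x ≤ A₄ * W :=
    hk (volume.restrict U) (fun u => powDist p (f u) 0) (fun u => u) τ (by fun_prop) (by fun_prop)
      (by fun_prop) hτ0
  have hpt : ∀ x, ρ x ≠ 0 → powDist p (F x) 0 * epow (τ x) (-(s * p)) ≤
      c * epow 2 γ * crossDensity s p ρ U f F x + c * epow 3 γ * Q x := by
    intro x hx
    have hx0 : 0 < ρ x := lt_of_le_of_ne (H.nonneg x) hx.symm
    rcases le_or_gt 2 (ρ x) with h | h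
    · simp [HF.eq_zero x h, powDist_self hp]
    have hτx : ρ x ≤ 2 * τ x := hρτ x h
    have hτ1 : 0 < τ x := by linarith
    set t := 8 * τ x with ht
    have ht0 : 0 < t := by positivity
    have hBm : MeasurableSet (ball x t ∩ U) := measurableSet_ball.inter H.meas
    have e1 : epow t (-γ) * ∫⁻ u in ball x t ∩ U, powDist p (f u) (F x) ≤
        epow 2 γ * crossDensity s p ρ U f F x := by
      rw [crossDensity, add_comm (s * p)]
      refine epow_mul_setLIntegral_le hBm Set.inter_subset_right ht0 two_pos hγ0 _ _ fun u hu => ?_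
      have h1 := mem_ball.1 hu.1
      rw [dist_comm] at h1
      linarith
    have e2 : epow t (-γ) * ∫⁻ u in ball x t ∩ U, powDist p (f u) 0 ≤ epow 3 γ * Q x := by
      refine epow_mul_setLIntegral_le hBm Set.inter_subset_right ht0 three_pos hγ0 _ _
        fun u hu => ?_
      have h1 := mem_ball.1 hu.1
      have h2 : τ u ≤ τ x + dist u x := by simpa using hτ.le_add_mul u x
      rw [dist_comm x u]
      linarith
    have e3 : epow t (-d) * epow (τ x) (-(s * p)) = epow 8 (s * p) * epow t (-γ) := by
      rw [show -γ = -(d : ℝ) + -(s * p) by rw [hγ]; ring, ← epow_mul_epow ht0]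
      conv_rhs => rw [ht, epow_mul (by norm_num) (-(s * p))]
      calc _ = 1 * epow t (-d) * epow (τ x) (-(s * p)) := by ring
        _ = (epow 8 (s * p) * epow 8 (-(s * p))) * epow t (-d) * epow (τ x) (-(s * p)) := by
            rw [epow_mul_epow (by norm_num)]; simp [epow]
        _ = _ := by ring
    calc powDist p (F x) 0 * epow (τ x) (-(s * p))
        ≤ θ⁻¹ * epow 2 p * epow t (-d) * ((∫⁻ u in ball x t ∩ U, powDist p (f u) (F x)) +
          ∫⁻ u in ball x t ∩ U, powDist p (f u) 0) * epow (τ x) (-(s * p)) := by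
          gcongr
          exact powDist_le_average hp hf hθ hθ' ht0 (hthick ρ U H.lip H.nonneg H.meas H.null
            H.thick x t ht0 (by linarith)) _ _
      _ = θ⁻¹ * epow 2 p * (epow t (-d) * epow (τ x) (-(s * p))) *
          ((∫⁻ u in ball x t ∩ U, powDist p (f u) (F x)) +
            ∫⁻ u in ball x t ∩ U, powDist p (f u) 0) := by ring
      _ = c * (epow t (-γ) * (∫⁻ u in ball x t ∩ U, powDist p (f u) (F x))) +
            c * (epow t (-γ) * ∫⁻ u in ball x t ∩ U, powDist p (f u) 0) := by
          rw [e3, hcdef]; ring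
      _ ≤ c * (epow 2 γ * crossDensity s p ρ U f F x) + c * (epow 3 γ * Q x) :=
          add_le_add (mul_le_mul' le_rfl e1) (mul_le_mul' le_rfl e2)
      _ = _ := by ring
  set Z := {x | ρ x = 0} with hZ
  have hZm : MeasurableSet Z := hρm (measurableSet_singleton 0)
  have h1 : ∫⁻ x in Z, powDist p (F x) 0 * epow (τ x) (-(s * p)) ≤ W := by
    calc ∫⁻ x in Z, powDist p (F x) 0 * epow (τ x) (-(s * p))
        ≤ ∫⁻ x in (Z ∩ U) ∪ (Z \ U), powDist p (F x) 0 * epow (τ x) (-(s * p)) := by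
          rw [Set.inter_union_sdiff]
      _ ≤ (∫⁻ x in Z ∩ U, powDist p (F x) 0 * epow (τ x) (-(s * p))) +
            ∫⁻ x in Z \ U, powDist p (F x) 0 * epow (τ x) (-(s * p)) :=
          lintegral_union_le _ _ _
      _ = ∫⁻ x in Z ∩ U, powDist p (F x) 0 * epow (τ x) (-(s * p)) := by
          rw [setLIntegral_measure_zero _ _ H.null, add_zero]
      _ = ∫⁻ x in Z ∩ U, powDist p (f x) 0 * epow (τ x) (-(s * p)) :=
          setLIntegral_congr_fun (hZm.inter H.meas) fun x hx => by
            simp only [HF.eq x hx.1]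
      _ ≤ W := lintegral_mono_set Set.inter_subset_right
  have h2 : ∫⁻ x in Zᶜ, powDist p (F x) 0 * epow (τ x) (-(s * p)) ≤
      c * epow 2 γ * (A₃ * fullEnergy d s p U f) + c * epow 3 γ * (A₄ * W) := by
    calc ∫⁻ x in Zᶜ, powDist p (F x) 0 * epow (τ x) (-(s * p))
        ≤ ∫⁻ x in Zᶜ, (c * epow 2 γ * crossDensity s p ρ U f F x + c * epow 3 γ * Q x) :=
          setLIntegral_mono' hZm.compl fun x hx => hpt x hx
      _ ≤ ∫⁻ x, (c * epow 2 γ * crossDensity s p ρ U f F x + c * epow 3 γ * Q x) :=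
          setLIntegral_le_lintegral _ _
      _ = c * epow 2 γ * (∫⁻ x, crossDensity s p ρ U f F x) + c * epow 3 γ * ∫⁻ x, Q x := by
          rw [lintegral_add_right _ (hQm.const_mul _), lintegral_const_mul' _ _ (by finiteness),
            lintegral_const_mul' _ _ (by finiteness)]
      _ ≤ _ := add_le_add (mul_le_mul' le_rfl (hcross ρ U f F H HF)) (mul_le_mul' le_rfl hQint)
  rw [← lintegral_add_compl _ hZm]
  calc _ ≤ W + (c * epow 2 γ * (A₃ * fullEnergy d s p U f) + c * epow 3 γ * (A₄ * W)) :=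
        add_le_add h1 h2
    _ = (1 + c * epow 3 γ * A₄) * W + (c * epow 2 γ * A₃) * fullEnergy d s p U f := by ring
    _ ≤ (1 + (c * epow 2 γ * A₃ + c * epow 3 γ * A₄)) * W +
          (1 + (c * epow 2 γ * A₃ + c * epow 3 γ * A₄)) * fullEnergy d s p U f := by
        gcongr
        · exact le_add_left le_rfl
        · exact le_add_left (le_add_right le_rfl)
    _ = _ := by ring

lemma volume_frontier_eq_zero_of_thick {d : ℕ} {c : ℝ} (hc : 0 < c)
    {O D : Set (EuclideanSpace ℝ (Fin d))} (hO : IsOpen O)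
    (hthick : ∀ x ∈ frontier O \ D, ∀ r : ℝ, 0 < r → r ≤ 1 →
      ENNReal.ofReal c * volume (ball x r) ≤ volume (ball x r ∩ O)) :
    volume {x | x ∈ frontier O ∧ 0 < infDist x D} = 0 := by
  set S := {x | x ∈ frontier O ∧ 0 < infDist x D} with hS
  have hSm : MeasurableSet S := isClosed_frontier.measurableSet.inter
    (measurableSet_lt measurable_const (continuous_infDist_pt D).measurable)
  have h := Besicovitch.ae_tendsto_measure_inter_div (volume : Measure (EuclideanSpace ℝ (Fin d))) S
  have hF : ∀ᵐ x ∂(volume.restrict S), False := by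
    filter_upwards [h, ae_restrict_mem hSm] with x hx hxS
    have hxD : x ∉ D := fun hD => by
      have := hxS.2; rw [infDist_zero_of_mem hD] at this; exact lt_irrefl _ this
    have hev : ∀ᶠ r in nhdsWithin (0 : ℝ) (Set.Ioi 0),
        volume (S ∩ closedBall x r) / volume (closedBall x r) + ENNReal.ofReal c ≤ 1 := by
      filter_upwards [Ioc_mem_nhdsGT one_pos] with r hr
      have h0 : volume (closedBall x r) ≠ 0 := (measure_closedBall_pos _ _ hr.1).ne'
      have ht : volume (closedBall x r) ≠ ⊤ := measure_closedBall_lt_top.ne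
      have hdisj : Disjoint (S ∩ closedBall x r) (ball x r ∩ O) := by
        rw [Set.disjoint_left]
        rintro y ⟨⟨hy, -⟩, -⟩ ⟨-, hyO⟩
        rw [hO.frontier_eq] at hy
        exact hy.2 hyO
      have h1 : volume (S ∩ closedBall x r) + ENNReal.ofReal c * volume (closedBall x r) ≤
          volume (closedBall x r) := by
        calc _ ≤ volume (S ∩ closedBall x r) + volume (ball x r ∩ O) := by
              gcongr
              rw [Measure.addHaar_closedBall _ _ hr.1.le, ← Measure.addHaar_ball_of_pos _ _ hr.1]
              exact hthick x ⟨hxS.1, hxD⟩ r hr.1 hr.2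
          _ = volume ((S ∩ closedBall x r) ∪ (ball x r ∩ O)) :=
              (measure_union hdisj (measurableSet_ball.inter hO.measurableSet)).symm
          _ ≤ _ := measure_mono (Set.union_subset Set.inter_subset_right
              (Set.inter_subset_left.trans ball_subset_closedBall))
      calc volume (S ∩ closedBall x r) / volume (closedBall x r) + ENNReal.ofReal c
          = (volume (S ∩ closedBall x r) + ENNReal.ofReal c * volume (closedBall x r)) /
              volume (closedBall x r) := by
            rw [ENNReal.add_div, ENNReal.mul_div_cancel_right h0 ht]
        _ ≤ volume (closedBall x r) / volume (closedBall x r) := by gcongr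
        _ ≤ 1 := ENNReal.div_self_le_one
    have hlim := le_of_tendsto (hx.add_const (ENNReal.ofReal c)) hev
    have h2 : ENNReal.ofReal c ≤ 0 := by
      refine (ENNReal.add_le_add_iff_left one_ne_top).1 ?_
      simpa using hlim
    exact absurd h2 (not_le.2 (ENNReal.ofReal_pos.2 hc))
  have := ae_iff.1 hF
  simpa using this

/-- The scale at which an extension from `O` respects the distance to `D`. -/
noncomputable def cutDist {d : ℕ} (D : Set (EuclideanSpace ℝ (Fin d)))
    (x : EuclideanSpace ℝ (Fin d)) : ℝ := min 1 (infDist x D)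

lemma lipschitzWith_cutDist {d : ℕ} (D : Set (EuclideanSpace ℝ (Fin d))) :
    LipschitzWith 1 (cutDist D) := (lipschitz_infDist_pt D).const_min 1

lemma cutDist_nonneg {d : ℕ} (D : Set (EuclideanSpace ℝ (Fin d))) (x : EuclideanSpace ℝ (Fin d)) :
    0 ≤ cutDist D x := le_min zero_le_one infDist_nonneg

lemma cutDist_le_add {d : ℕ} (D : Set (EuclideanSpace ℝ (Fin d))) (y z : EuclideanSpace ℝ (Fin d)) :
    cutDist D y ≤ cutDist D z + dist y z := by simpa using (lipschitzWith_cutDist D).le_add_mul y z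

/-- The set `O`, enlarged by the part of its complement that is close to `D` compared with `O`. -/
def enlarged {d : ℕ} (O D : Set (EuclideanSpace ℝ (Fin d))) : Set (EuclideanSpace ℝ (Fin d)) :=
  O ∪ {x | cutDist D x ≤ 2 * infDist x O}

lemma powDist_zero (p a : ℝ) : powDist p a 0 = ENNReal.ofReal (|a| ^ p) := by simp [powDist]

lemma setLIntegral_powDist_indicator_le {d : ℕ} {p : ℝ} (hp : 0 < p)
    {O U : Set (EuclideanSpace ℝ (Fin d))} (hO : MeasurableSet O)
    (f : EuclideanSpace ℝ (Fin d) → ℝ) (w : EuclideanSpace ℝ (Fin d) → ℝ≥0∞) :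
    ∫⁻ u in U, powDist p (O.indicator f u) 0 * w u ≤
      ∫⁻ u in O, ENNReal.ofReal (|f u| ^ p) * w u := by
  refine (setLIntegral_le_lintegral _ _).trans ?_
  rw [← lintegral_indicator hO]
  refine lintegral_mono fun u => ?_
  by_cases hu : u ∈ O
  · simp [hu, powDist_zero]
  · simp [hu, powDist_self hp]

lemma isThickData_of_thick {d : ℕ} {p c : ℝ} (hp : 0 < p) (hc : 0 < c)
    {O D : Set (EuclideanSpace ℝ (Fin d))} (hO : IsOpen O) (hOne : O.Nonempty)
    (hthick : ∀ x ∈ frontier O \ D, ∀ r : ℝ, 0 < r → r ≤ 1 →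
      ENNReal.ofReal c * volume (ball x r) ≤ volume (ball x r ∩ O))
    {f : EuclideanSpace ℝ (Fin d) → ℝ} (hf : Measurable f) (hfin : lpPow d p O f < ⊤) :
    IsThickData p (min (ENNReal.ofReal c) (epow (1 / 8) d) *
      volume (ball (0 : EuclideanSpace ℝ (Fin d)) 1)) (fun x => infDist x O) (enlarged O D)
      (O.indicator f) := by
  set v := volume (ball (0 : EuclideanSpace ℝ (Fin d)) 1) with hv
  set c₀ := min (ENNReal.ofReal c) (epow (1 / 8) d) * v with hc₀
  have hv0 : v ≠ 0 := (measure_ball_pos _ _ one_pos).ne'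
  have hc₀0 : c₀ ≠ 0 := mul_ne_zero (lt_min (ENNReal.ofReal_pos.2 hc)
    (pos_iff_ne_zero.2 (epow_ne_zero (by norm_num) _))).ne' hv0
  have hlip : LipschitzWith 1 fun x => infDist x O := lipschitz_infDist_pt O
  have hl : ∀ y z, infDist y O ≤ infDist z O + dist y z := fun y z => infDist_le_infDist_add_dist
  have hUm : MeasurableSet (enlarged O D) := hO.measurableSet.union
    (measurableSet_le (lipschitzWith_cutDist D).continuous.measurable
      (hlip.continuous.measurable.const_mul 2))
  have hfm : Measurable (O.indicator f) := hf.indicator hO.measurableSet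
  have hclose : ∀ x, 0 < infDist x O → infDist x O < cutDist D x →
      ∃ B ⊆ ball x (2 * infDist x O) ∩ enlarged O D, c₀ * epow (infDist x O) d ≤ volume B ∧
        volume B ≠ ⊤ := by
    intro x hx hxτ
    have hxc : x ∈ (closure O)ᶜ := fun h => by
      rw [mem_closure_iff_infDist_zero hOne] at h; exact hx.ne' h
    obtain ⟨ξ, hξ, hdist⟩ := exists_mem_frontier_infDist_compl_eq_dist hxc
      (fun h => by
        rw [Set.compl_univ_iff] at h
        exact hOne.ne_empty ((closure_empty_iff _).1 h))
    rw [frontier_compl] at hξ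
    rw [compl_compl, infDist_closure] at hdist
    have hξD : ξ ∉ D := fun h => by
      have h1 := infDist_le_dist_of_mem (x := x) h
      have h2 : cutDist D x ≤ infDist x D := min_le_right _ _
      linarith
    have hx1 : infDist x O ≤ 1 := hxτ.le.trans (min_le_left _ _)
    have hsub : ball ξ (infDist x O) ∩ O ⊆ ball x (2 * infDist x O) ∩ enlarged O D := by
      refine Set.inter_subset_inter (ball_subset_ball' ?_) Set.subset_union_left
      rw [dist_comm, ← hdist]; linarith
    refine ⟨_, hsub, ?_, ((measure_mono Set.inter_subset_left).trans_lt measure_ball_lt_top).ne⟩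
    refine le_trans ?_ (hthick ξ ⟨frontier_closure_subset hξ, hξD⟩ _ hx hx1)
    rw [volume_ball_eq _ hx, hc₀]
    calc _ ≤ ENNReal.ofReal c * v * epow (infDist x O) d := by gcongr; exact min_le_left _ _
      _ = _ := by ring
  have hfar : ∀ x, 0 < infDist x O → cutDist D x ≤ infDist x O →
      ball x (infDist x O / 8) ⊆ ball x (2 * infDist x O) ∩ enlarged O D ∧
        c₀ * epow (infDist x O) d ≤ volume (ball x (infDist x O / 8)) ∧
        ∀ w ∈ ball x (infDist x O / 8), O.indicator f w = 0 := by
    intro x hx hxτ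
    have hw : ∀ w ∈ ball x (infDist x O / 8), 7 / 8 * infDist x O ≤ infDist w O := fun w hw => by
      have h1 := hl x w
      have h2 := mem_ball'.1 hw
      linarith
    refine ⟨fun w hwx => ⟨ball_subset_ball (by linarith) hwx, Or.inr ?_⟩, ?_, fun w hwx => ?_⟩
    · have h1 := hw w hwx
      have h2 := cutDist_le_add D w x
      have h3 := mem_ball.1 hwx
      simp only [Set.mem_ofPred_eq]
      linarith
    · rw [show infDist x O / 8 = 1 / 8 * infDist x O by ring, volume_ball_eq _ (by positivity),
        epow_mul (by norm_num), hc₀]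
      calc _ ≤ epow (1 / 8) d * v * epow (infDist x O) d := by gcongr; exact min_le_right _ _
        _ = _ := by ring
    · refine Set.indicator_of_notMem (fun hwO => ?_) f
      have h1 := hw w hwx
      rw [infDist_zero_of_mem hwO] at h1
      linarith
  refine ⟨hlip, fun x => infDist_nonneg, hUm, ?_, fun x hx => ?_, fun x hx => ?_, hfm, ?_⟩
  · refine measure_mono_null ?_ (volume_frontier_eq_zero_of_thick hc hO hthick)
    rintro x ⟨hx, hxU⟩
    simp only [enlarged, Set.mem_union, Set.mem_ofPred_eq, not_or, not_le] at hx hxU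
    rw [hx, mul_zero] at hxU
    refine ⟨?_, hxU.2.trans_le (min_le_right _ _)⟩
    rw [hO.frontier_eq]
    exact ⟨(mem_closure_iff_infDist_zero hOne).2 hx, hxU.1⟩
  · rcases lt_or_ge (infDist x O) (cutDist D x) with h | h
    · obtain ⟨B, hB, hvol, -⟩ := hclose x hx h
      exact hvol.trans (measure_mono hB)
    · obtain ⟨hB, hvol, -⟩ := hfar x hx h
      exact hvol.trans (measure_mono hB)
  · set B := ball x (2 * infDist x O) ∩ enlarged O D with hBdef
    set g : EuclideanSpace ℝ (Fin d) → ℝ≥0∞ := fun w =>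
      ∫⁻ u in B, powDist p (O.indicator f u) (O.indicator f w) with hg
    have hgm : Measurable g := Measurable.lintegral_prod_right' (f := fun q :
      EuclideanSpace ℝ (Fin d) × EuclideanSpace ℝ (Fin d) =>
      powDist p (O.indicator f q.2) (O.indicator f q.1)) (by fun_prop)
    have hgB : ∀ B' ⊆ B, ∫⁻ w in B', g w ≤ flatEnergy p B (O.indicator f) := fun B' hB' => by
      refine (lintegral_mono_set hB').trans_eq ?_
      simp only [hg, flatEnergy]
      simp_rw [powDist_comm p]
    rcases lt_or_ge (infDist x O) (cutDist D x) with h | h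
    · obtain ⟨B', hB', hvol, hvt⟩ := hclose x hx h
      have hv0' : volume B' ≠ 0 := fun h0 => by
        rw [h0, nonpos_iff_eq_zero, mul_eq_zero] at hvol
        exact hvol.elim hc₀0 (epow_ne_zero hx _)
      obtain ⟨w, -, hw⟩ := exists_le_setLAverage hv0' hvt hgm.aemeasurable
      refine ⟨O.indicator f w, ?_, fun h1 => absurd (h.trans_le (min_le_left _ _)) (not_lt.2 h1)⟩
      calc _ ≤ volume B' * g w := by gcongr
        _ ≤ volume B' * ((∫⁻ w in B', g w) / volume B') := by rw [← setLAverage_eq]; gcongr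
        _ = ∫⁻ w in B', g w := ENNReal.mul_div_cancel hv0' hvt
        _ ≤ _ := hgB B' hB'
    · obtain ⟨hB', hvol, hzero⟩ := hfar x hx h
      refine ⟨0, ?_, fun _ => rfl⟩
      calc _ ≤ volume (ball x (infDist x O / 8)) * ∫⁻ u in B, powDist p (O.indicator f u) 0 := by
            gcongr
        _ = ∫⁻ w in ball x (infDist x O / 8), ∫⁻ u in B, powDist p (O.indicator f u) 0 := by
            rw [setLIntegral_const, mul_comm]
        _ = ∫⁻ w in ball x (infDist x O / 8), g w :=
            setLIntegral_congr_fun measurableSet_ball fun w hw => by simp only [hg, hzero w hw]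
        _ ≤ _ := hgB _ hB'
  · have := setLIntegral_powDist_indicator_le (U := enlarged O D) hp hO.measurableSet f (fun _ => 1)
    simp only [mul_one] at this
    exact this.trans_lt hfin

lemma gagliardo_integrand_eq {X : Type*} [MetricSpace X] {p : ℝ} (hp : 0 < p) (γ : ℝ) (f : X → ℝ)
    (x y : X) : ENNReal.ofReal (|f x - f y| ^ p / dist x y ^ γ) =
      powDist p (f x) (f y) * epow (dist x y) (-γ) := by
  rcases eq_or_ne x y with rfl | h
  · simp [powDist_self hp, Real.zero_rpow hp.ne']
  · have hd := dist_pos.2 h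
    rw [powDist, epow_eq_ofReal hd, ← ENNReal.ofReal_mul (by positivity), Real.rpow_neg hd.le,
      div_eq_mul_inv]

/-- The integrand of the fractional Sobolev seminorm on `O`, extended by zero. -/
noncomputable def localIntegrand {d : ℕ} (p γ : ℝ) (O : Set (EuclideanSpace ℝ (Fin d)))
    (f : EuclideanSpace ℝ (Fin d) → ℝ) (x y : EuclideanSpace ℝ (Fin d)) : ℝ≥0∞ :=
  ({q : EuclideanSpace ℝ (Fin d) × EuclideanSpace ℝ (Fin d) | q.1 ∈ O ∧ q.2 ∈ O ∧
    dist q.1 q.2 < 1}).indicator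
      (fun q => powDist p (f q.1) (f q.2) * epow (dist q.1 q.2) (-γ)) (x, y)

lemma measurable_localIntegrand {d : ℕ} (p γ : ℝ) {O : Set (EuclideanSpace ℝ (Fin d))}
    (hO : IsOpen O) {f : EuclideanSpace ℝ (Fin d) → ℝ} (hf : Measurable f) :
    Measurable fun q : EuclideanSpace ℝ (Fin d) × EuclideanSpace ℝ (Fin d) =>
      localIntegrand p γ O f q.1 q.2 := by
  unfold localIntegrand
  refine Measurable.indicator (by fun_prop) ?_
  exact ((hO.preimage continuous_fst).inter ((hO.preimage continuous_snd).inter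
    (isOpen_lt (continuous_fst.dist continuous_snd) continuous_const))).measurableSet

lemma gagliardoPow_eq {d : ℕ} {s p : ℝ} (hp : 0 < p) {O : Set (EuclideanSpace ℝ (Fin d))}
    (hO : IsOpen O) (f : EuclideanSpace ℝ (Fin d) → ℝ) :
    gagliardoPow d s p O f = ∫⁻ x, ∫⁻ y, localIntegrand p (s * p + d) O f x y := by
  unfold gagliardoPow
  rw [← lintegral_indicator hO.measurableSet]
  refine lintegral_congr fun x => ?_
  by_cases hx : x ∈ O
  · have hB : IsOpen (O ∩ {y | dist x y < 1}) :=
      hO.inter (isOpen_lt (continuous_const.dist continuous_id) continuous_const)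
    rw [Set.indicator_of_mem hx, ← lintegral_indicator hB.measurableSet]
    refine lintegral_congr fun y => ?_
    by_cases hy : y ∈ O ∩ {y | dist x y < 1}
    · rw [Set.indicator_of_mem hy, gagliardo_integrand_eq hp, localIntegrand,
        Set.indicator_of_mem (Set.mem_ofPred_eq ▸ ⟨hx, hy.1, hy.2⟩)]
    · rw [Set.indicator_of_notMem hy, localIntegrand,
        Set.indicator_of_notMem fun h => hy ⟨h.2.1, h.2.2⟩]
  · rw [Set.indicator_of_notMem hx]
    refine (lintegral_eq_zero_of_ae_eq_zero (Filter.Eventually.of_forall fun y => ?_)).symm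
    exact Set.indicator_of_notMem (fun h => hx h.1) _

/-- Mass of `f` at `y` seen from `x` at the scale `cutDist D y`. -/
noncomputable def tailIntegrand {d : ℕ} (p γ : ℝ) (D : Set (EuclideanSpace ℝ (Fin d)))
    (g : EuclideanSpace ℝ (Fin d) → ℝ) (x y : EuclideanSpace ℝ (Fin d)) : ℝ≥0∞ :=
  powDist p (g y) 0 * epow (dist x y + cutDist D y) (-γ)

lemma mul_epow_dist_le_tailIntegrand {d : ℕ} {p γ : ℝ} (hp : 0 < p) (hγ : 0 ≤ γ)
    {O D : Set (EuclideanSpace ℝ (Fin d))} (f : EuclideanSpace ℝ (Fin d) → ℝ)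
    {x y : EuclideanSpace ℝ (Fin d)} (hx : x ∈ enlarged O D)
    (h : ¬(x ∈ O ∧ y ∈ O ∧ dist x y < 1)) :
    powDist p (O.indicator f y) 0 * epow (dist x y) (-γ) ≤
      epow 4 γ * tailIntegrand p γ D (O.indicator f) x y := by
  by_cases hy : y ∈ O
  · have hτ : cutDist D y ≤ 3 * dist x y := by
      by_cases hxO : x ∈ O
      · have h1 : 1 ≤ dist x y := not_lt.1 fun h1 => h ⟨hxO, hy, h1⟩
        have h2 : cutDist D y ≤ 1 := min_le_left _ _
        linarith
      · have h1 : cutDist D x ≤ 2 * infDist x O := hx.resolve_left hxO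
        have h2 : infDist x O ≤ dist x y := infDist_le_dist_of_mem hy
        have h3 := cutDist_le_add D y x
        rw [dist_comm] at h3
        linarith
    calc _ ≤ powDist p (O.indicator f y) 0 *
          (epow 4 γ * epow (dist x y + cutDist D y) (-γ)) :=
          mul_le_mul' le_rfl (epow_neg_le hγ (by norm_num) (by linarith))
      _ = _ := by rw [tailIntegrand]; ring
  · simp [hy, powDist_self hp]

lemma fullEnergy_enlarged_le (d : ℕ) {s p : ℝ} (hs : 0 < s) (hp : 0 < p) :
    ∃ A : ℝ≥0∞, A ≠ ⊤ ∧ ∀ O D : Set (EuclideanSpace ℝ (Fin d)), IsOpen O →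
      ∀ f : EuclideanSpace ℝ (Fin d) → ℝ, Measurable f →
      fullEnergy d s p (enlarged O D) (O.indicator f) ≤ gagliardoPow d s p O f +
        A * ∫⁻ x in O, ENNReal.ofReal (|f x| ^ p) * epow (cutDist D x) (-(s * p)) := by
  have hsp : 0 < s * p := mul_pos hs hp
  obtain ⟨C, hC, -, hk⟩ := lintegral_lintegral_kernel_le d hsp
  set γ := s * p + d with hγ
  have hγ0 : 0 ≤ γ := by positivity
  have hc2 := epow_ne_top two_pos p
  have hc4 := epow_ne_top (show (0 : ℝ) < 4 by norm_num) γ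
  set c := epow 2 p * epow 4 γ with hc
  have hct : c ≠ ⊤ := mul_ne_top hc2 hc4
  refine ⟨c * (2 * C), mul_ne_top hct (mul_ne_top ofNat_ne_top hC), fun O D hO f hf => ?_⟩
  set g := O.indicator f with hg
  have hgm : Measurable g := hf.indicator hO.measurableSet
  have hτm : Measurable (cutDist D) := (lipschitzWith_cutDist D).continuous.measurable
  have hUm : MeasurableSet (enlarged O D) := hO.measurableSet.union
    (measurableSet_le hτm ((lipschitz_infDist_pt O).continuous.measurable.const_mul 2))
  have hpt : ∀ x ∈ enlarged O D, ∀ y ∈ enlarged O D,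
      powDist p (g x) (g y) * epow (dist x y) (-γ) ≤ localIntegrand p γ O f x y +
        c * (tailIntegrand p γ D g x y + tailIntegrand p γ D g y x) := by
    intro x hx y hy
    by_cases h : x ∈ O ∧ y ∈ O ∧ dist x y < 1
    · refine le_add_of_le_of_nonneg ?_ (zero_le)
      rw [localIntegrand, Set.indicator_of_mem (show (x, y) ∈ _ from h), hg,
        Set.indicator_of_mem h.1, Set.indicator_of_mem h.2.1]
    · refine le_add_of_nonneg_of_le zero_le ?_
      have h1 := mul_epow_dist_le_tailIntegrand hp hγ0 f hx h
      have h2 := mul_epow_dist_le_tailIntegrand hp hγ0 f hy (y := x)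
        (fun h' => h ⟨h'.2.1, h'.1, by rw [dist_comm]; exact h'.2.2⟩)
      rw [dist_comm y x] at h2
      calc _ ≤ epow 2 p * (powDist p 0 (g x) + powDist p 0 (g y)) * epow (dist x y) (-γ) :=
            mul_le_mul' (powDist_le hp _ _ _) le_rfl
        _ = epow 2 p * (powDist p (g y) 0 * epow (dist x y) (-γ) +
              powDist p (g x) 0 * epow (dist x y) (-γ)) := by
            rw [powDist_comm p 0, powDist_comm p 0]; ring
        _ ≤ epow 2 p * (epow 4 γ * tailIntegrand p γ D g x y +
              epow 4 γ * tailIntegrand p γ D g y x) := mul_le_mul' le_rfl (add_le_add h1 h2)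
        _ = _ := by rw [hc]; ring
  have hLm := measurable_localIntegrand p γ hO hf
  have hTm : Measurable fun q : EuclideanSpace ℝ (Fin d) × EuclideanSpace ℝ (Fin d) =>
      tailIntegrand p γ D g q.1 q.2 := by unfold tailIntegrand; fun_prop
  have hLx : ∀ x, Measurable (localIntegrand p γ O f x) := fun x =>
    Measurable.of_uncurry_left (f := localIntegrand p γ O f) hLm
  calc fullEnergy d s p (enlarged O D) g
      ≤ ∫⁻ x in enlarged O D, ∫⁻ y in enlarged O D, (localIntegrand p γ O f x y +
        c * (tailIntegrand p γ D g x y + tailIntegrand p γ D g y x)) :=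
        setLIntegral_mono' hUm fun x hx => setLIntegral_mono' hUm fun y hy => hpt x hx y hy
    _ ≤ ∫⁻ x, ∫⁻ y, (localIntegrand p γ O f x y +
        c * (tailIntegrand p γ D g x y + tailIntegrand p γ D g y x)) :=
        (setLIntegral_le_lintegral _ _).trans
          (lintegral_mono fun x => setLIntegral_le_lintegral _ _)
    _ = ∫⁻ x, ((∫⁻ y, localIntegrand p γ O f x y) +
        c * ∫⁻ y, (tailIntegrand p γ D g x y + tailIntegrand p γ D g y x)) :=
        lintegral_congr fun x => by
          rw [lintegral_add_left (hLx x), lintegral_const_mul' _ _ hct]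
    _ = gagliardoPow d s p O f +
        c * (2 * ∫⁻ x, ∫⁻ y, tailIntegrand p γ D g x y) := by
        rw [lintegral_add_left (Measurable.lintegral_prod_right' hLm),
          lintegral_const_mul' _ _ hct, lintegral_lintegral_add_swap hTm, ← gagliardoPow_eq hp hO]
    _ ≤ gagliardoPow d s p O f +
        c * (2 * (C * ∫⁻ x, powDist p (g x) 0 * epow (cutDist D x) (-(s * p)))) := by
        refine add_le_add le_rfl (mul_le_mul' le_rfl (mul_le_mul' le_rfl ?_))
        have := hk volume (fun y => powDist p (g y) 0) id (cutDist D) (by fun_prop) measurable_id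
          hτm (cutDist_nonneg D)
        rw [add_comm (d : ℝ)] at this
        exact this
    _ ≤ _ := by
        rw [mul_assoc c, mul_assoc 2 C]
        refine add_le_add le_rfl (mul_le_mul' le_rfl (mul_le_mul' le_rfl (mul_le_mul' le_rfl ?_)))
        have := setLIntegral_powDist_indicator_le (U := Set.univ) hp hO.measurableSet f
          (fun x => epow (cutDist D x) (-(s * p)))
        rwa [setLIntegral_univ] at this

lemma epow_cutDist_le {d : ℕ} {γ : ℝ} (D : Set (EuclideanSpace ℝ (Fin d)))
    (x : EuclideanSpace ℝ (Fin d)) :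
    epow (cutDist D x) (-γ) ≤ 1 + ENNReal.ofReal (infDist x D) ^ (-γ) := by
  unfold cutDist
  rcases le_total 1 (infDist x D) with h | h
  · rw [min_eq_left h]; simp [epow]
  · rw [min_eq_right h]; exact le_add_self

lemma setLIntegral_cutDist_le {d : ℕ} {s p : ℝ} {O : Set (EuclideanSpace ℝ (Fin d))}
    (D : Set (EuclideanSpace ℝ (Fin d))) {f : EuclideanSpace ℝ (Fin d) → ℝ} (hf : Measurable f) :
    ∫⁻ x in O, ENNReal.ofReal (|f x| ^ p) * epow (cutDist D x) (-(s * p)) ≤ sobPow d s p O D f := by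
  have hm : Measurable fun x => ENNReal.ofReal (|f x| ^ p) := by
    simpa only [powDist_zero] using hf.powDist (measurable_const (a := (0 : ℝ))) p
  calc _ ≤ ∫⁻ x in O, (ENNReal.ofReal (|f x| ^ p) +
        ENNReal.ofReal (|f x| ^ p) * ENNReal.ofReal (infDist x D) ^ (-(s * p))) :=
        lintegral_mono fun x =>
          (mul_le_mul' le_rfl (epow_cutDist_le D x)).trans_eq (by rw [mul_add, mul_one])
    _ = lpPow d p O f + hardyPow d s p O D f := lintegral_add_left hm _
    _ ≤ _ := by
        unfold sobPow
        exact add_le_add le_self_add le_rfl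

lemma sobPow_univ_le {d : ℕ} {s p : ℝ} (hs : 0 < s) (hp : 0 < p)
    (D : Set (EuclideanSpace ℝ (Fin d))) (F : EuclideanSpace ℝ (Fin d) → ℝ) :
    sobPow d s p Set.univ D F ≤ fullEnergy d s p Set.univ F +
      2 * ∫⁻ x, powDist p (F x) 0 * epow (cutDist D x) (-(s * p)) := by
  have hsp : 0 ≤ s * p := (mul_pos hs hp).le
  have h1 : lpPow d p Set.univ F ≤ ∫⁻ x, powDist p (F x) 0 * epow (cutDist D x) (-(s * p)) := by
    rw [lpPow, setLIntegral_univ]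
    refine lintegral_mono fun x => ?_
    have : (1 : ℝ≥0∞) ≤ epow (cutDist D x) (-(s * p)) := by
      simpa [epow] using epow_anti hsp (show cutDist D x ≤ 1 from min_le_left _ _)
    simpa [powDist_zero] using mul_le_mul' (le_refl (ENNReal.ofReal (|F x| ^ p))) this
  have h2 : hardyPow d s p Set.univ D F ≤
      ∫⁻ x, powDist p (F x) 0 * epow (cutDist D x) (-(s * p)) := by
    rw [hardyPow, setLIntegral_univ]
    refine lintegral_mono fun x => ?_
    rw [powDist_zero]
    exact mul_le_mul' le_rfl (epow_anti hsp (min_le_right _ _))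
  have h3 : gagliardoPow d s p Set.univ F ≤ fullEnergy d s p Set.univ F := by
    unfold gagliardoPow fullEnergy
    refine lintegral_mono fun x => (lintegral_mono_set Set.inter_subset_left).trans_eq ?_
    exact lintegral_congr fun y => gagliardo_integrand_eq hp _ F x y
  calc _ ≤ _ := add_le_add (add_le_add h1 h3) h2
    _ = _ := by ring

lemma sobPow_zero {d : ℕ} {s p : ℝ} (hp : 0 < p) (U D : Set (EuclideanSpace ℝ (Fin d))) :
    sobPow d s p U D 0 = 0 := by
  simp [sobPow, lpPow, gagliardoPow, hardyPow, Real.zero_rpow hp.ne']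

lemma ae_eq_zero_of_hardyPow_empty {d : ℕ} {s p : ℝ} (hs : 0 < s) (hp : 0 < p)
    {O : Set (EuclideanSpace ℝ (Fin d))} {f : EuclideanSpace ℝ (Fin d) → ℝ} (hf : Measurable f)
    (h : hardyPow d s p O ∅ f < ⊤) : ∀ᵐ x ∂(volume.restrict O), f x = 0 := by
  have hm : Measurable fun x => ENNReal.ofReal (|f x| ^ p) := by
    simpa only [powDist_zero] using hf.powDist (measurable_const (a := (0 : ℝ))) p
  have hae := ae_lt_top (hm.mul_const (ENNReal.ofReal 0 ^ (-(s * p))))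
    (show ∫⁻ x in O, _ ≠ ⊤ by simpa [hardyPow] using h.ne)
  filter_upwards [hae] with x hx
  by_contra hne
  have h0 : ENNReal.ofReal (|f x| ^ p) ≠ 0 :=
    (ENNReal.ofReal_pos.2 (Real.rpow_pos_of_pos (abs_pos.2 hne) p)).ne'
  rw [ENNReal.ofReal_zero, ENNReal.zero_rpow_of_neg (neg_lt_zero.2 (mul_pos hs hp)),
    ENNReal.mul_top h0] at hx
  exact lt_irrefl _ hx

lemma exists_extension_of_nonempty (d : ℕ) (hd : 1 ≤ d) {s p c : ℝ}
    (hs0 : 0 < s) (hs1 : s < 1) (hp : 0 < p) (hc : 0 < c) :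
    ∃ C : ℝ≥0∞, C ≠ ⊤ ∧
      ∀ O D : Set (EuclideanSpace ℝ (Fin d)), IsOpen O → O.Nonempty → D.Nonempty →
        D ⊆ frontier O →
        (∀ x ∈ frontier O \ D, ∀ r : ℝ, 0 < r → r ≤ 1 →
          ENNReal.ofReal c * volume (ball x r) ≤ volume (ball x r ∩ O)) →
        ∀ f : EuclideanSpace ℝ (Fin d) → ℝ, Measurable f → sobPow d s p O D f < ⊤ →
          ∃ F : EuclideanSpace ℝ (Fin d) → ℝ, Measurable F ∧ (∀ x ∈ O, F x = f x) ∧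
            sobPow d s p Set.univ D F ≤ C * sobPow d s p O D f := by
  set c₀ := min (ENNReal.ofReal c) (epow (1 / 8) d) *
    volume (ball (0 : EuclideanSpace ℝ (Fin d)) 1) with hc₀
  have hc0 : c₀ ≠ 0 := mul_ne_zero (lt_min (ENNReal.ofReal_pos.2 hc)
    (pos_iff_ne_zero.2 (epow_ne_zero (by norm_num) _))).ne' (measure_ball_pos _ _ one_pos).ne'
  have hct : c₀ ≠ ⊤ := mul_ne_top (min_lt_of_left_lt ofReal_lt_top).ne measure_ball_lt_top.ne
  obtain ⟨C, hC, C', hC', hext⟩ := exists_adapted_extension d hp hc0 hct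
  obtain ⟨A₁, hA₁, hfull⟩ := fullEnergy_univ_le d hd hs0 hs1 hp hc0 hct hC hC'
  obtain ⟨A₂, hA₂, hweight⟩ := lintegral_weight_le d hs0 hp hc0 hct (C := C) hC'
  obtain ⟨A₃, hA₃, henl⟩ := fullEnergy_enlarged_le d hs0 hp
  refine ⟨A₁ * (1 + A₃) + 2 * (A₂ * (1 + (1 + A₃))), by finiteness,
    fun O D hO hOne hDne hD hthick f hf hfin => ?_⟩
  have hdata := isThickData_of_thick hp hc hO hOne hthick hf
    ((le_self_add.trans le_self_add).trans_lt hfin)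
  obtain ⟨F, hF⟩ := hext _ _ _ hdata
  refine ⟨F, hF.meas, fun x hx => ?_, ?_⟩
  · rw [hF.eq x (infDist_zero_of_mem hx), Set.indicator_of_mem hx]
  have hle : ∀ x, infDist x O < 2 → infDist x O ≤ 2 * cutDist D x := fun x hx => by
    have h1 : infDist x O ≤ infDist x D := by
      rw [← infDist_closure]
      exact infDist_le_infDist_of_subset (hD.trans frontier_subset_closure) hDne
    have h2 := infDist_nonneg (x := x) (s := D)
    unfold cutDist
    rcases le_total 1 (infDist x D) with h | h
    · rw [min_eq_left h]; linarith
    · rw [min_eq_right h]; linarith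
  have hE := hfull _ _ _ F hdata hF
  have hW := hweight _ (cutDist D) _ _ F hdata hF (lipschitzWith_cutDist D) (cutDist_nonneg D) hle
  set S := sobPow d s p O D f with hS
  have hcut := setLIntegral_cutDist_le (s := s) (p := p) (O := O) D hf
  have hen : fullEnergy d s p (enlarged O D) (O.indicator f) ≤ (1 + A₃) * S := by
    refine (henl O D hO f hf).trans ?_
    rw [add_mul, one_mul]
    refine add_le_add ?_ (mul_le_mul' le_rfl hcut)
    rw [hS, sobPow]
    exact le_add_self.trans le_self_add
  have hin := (setLIntegral_powDist_indicator_le (U := enlarged O D) hp hO.measurableSet f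
    (fun x => epow (cutDist D x) (-(s * p)))).trans hcut
  calc _ ≤ _ := sobPow_univ_le hs0 hp D F
    _ ≤ A₁ * ((1 + A₃) * S) + 2 * (A₂ * (S + (1 + A₃) * S)) :=
      add_le_add (hE.trans (mul_le_mul' le_rfl hen))
        (mul_le_mul' le_rfl (hW.trans (mul_le_mul' le_rfl (add_le_add hin hen))))
    _ = _ := by ring

/-- If `O ⊆ ℝ^d` is open, `D ⊆ ∂O`, and `O` satisfies the interior
thickness condition in `∂O \ D` with constant `c > 0`, then every measurable `f` with
finite `W^{s,p}_D(O)`-norm admits a measurable whole-space extension `F` whose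
`W^{s,p}_D(ℝ^d)`-norm is controlled by a constant `C = C(d,s,p,c)` times that of `f`. -/
theorem extension_for_WspD (d : ℕ) (hd : 1 ≤ d) (s p c : ℝ)
    (hs0 : 0 < s) (hs1 : s < 1) (hp : 0 < p) (hc : 0 < c) :
    ∃ C : ℝ, 0 < C ∧
      ∀ O D : Set (EuclideanSpace ℝ (Fin d)), IsOpen O → D ⊆ frontier O →
        (∀ x ∈ frontier O \ D, ∀ r : ℝ, 0 < r → r ≤ 1 →
          ENNReal.ofReal c * volume (Metric.ball x r) ≤ volume (Metric.ball x r ∩ O)) →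
        ∀ f : EuclideanSpace ℝ (Fin d) → ℝ, Measurable f →
          sobPow d s p O D f < ⊤ →
          ∃ F : EuclideanSpace ℝ (Fin d) → ℝ, Measurable F ∧
            (∀ᵐ x ∂(volume.restrict O), F x = f x) ∧
            sobPow d s p Set.univ D F ≤ ENNReal.ofReal C * sobPow d s p O D f := by
  obtain ⟨C, hC, h⟩ := exists_extension_of_nonempty d hd hs0 hs1 hp hc
  refine ⟨C.toReal + 1, by positivity, fun O D hO hD hthick f hf hfin => ?_⟩
  rcases O.eq_empty_or_nonempty with rfl | hOne
  · exact ⟨0, measurable_const, by simp, by simp [sobPow_zero hp]⟩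
  rcases D.eq_empty_or_nonempty with rfl | hDne
  · have h0 := ae_eq_zero_of_hardyPow_empty hs0 hp hf (le_add_self.trans_lt hfin)
    refine ⟨0, measurable_const, ?_, by simp [sobPow_zero hp]⟩
    filter_upwards [h0] with x hx using hx.symm
  obtain ⟨F, hFm, hF, hle⟩ := h O D hO hOne hDne hD hthick f hf hfin
  refine ⟨F, hFm, (ae_restrict_mem hO.measurableSet).mono hF, hle.trans ?_⟩
  refine mul_le_mul' ?_ le_rfl
  rw [← ENNReal.ofReal_toReal hC]
  refine ENNReal.ofReal_le_ofReal ?_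
  rw [ENNReal.toReal_ofReal ENNReal.toReal_nonneg]
  linarith
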